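/- arXiv:math/0604413 — 15 statements merged into one kernel-verified Lean document; each statement's English description precedes it below -/
import Mathlib

section
/- Let p be an odd prime, let r be a power of p, and let q be a power of r. Let c be an element of the field with q^2 elements that does not lie in the subfield with q elements (equivalently, c^q ≠ c; in particular c ≠ 0). If the element (c^{r-1} + 1)^{(r+1)/2} / c^{r(r-1)/2} lies in the subfield with q elements (i.e., is fixed by the map x ↦ x^q), then the trace of c from F_{q^2} to F_r is zero. -/
/-- If `σ x = x + c` with `c` not in the kernel of `1 + σ`, then `1, x, x²` are linearly independent
over the fixed field of `σ`. -/
theorem quadratic_coeffs_eq_zero_of_map_eq_add {L : Type*} [Field L] (σ : L →+* L) {x c A B C : L}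
    (hx : σ x = x + c) (hc : c ≠ 0) (hcc : c + σ c ≠ 0)
    (hA : σ A = A) (hB : σ B = B) (hC : σ C = C) (h : A * x ^ 2 + B * x + C = 0) :
    A = 0 ∧ B = 0 ∧ C = 0 := by
  have h1 := congrArg σ h
  simp only [map_add, map_mul, map_pow, map_zero, hx, hA, hB, hC] at h1
  have h2 : A * (2 * x + c) + B = 0 := by
    apply mul_left_cancel₀ hc
    linear_combination h1 - h
  have h3 := congrArg σ h2
  simp only [map_add, map_mul, map_zero, map_ofNat, hx, hA, hB] at h3
  have hA0 : A = 0 := by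
    have : A * (c + σ c) = 0 := by linear_combination h3 - h2
    exact (mul_eq_zero.mp this).resolve_right hcc
  subst hA0
  have hB0 : B = 0 := by linear_combination h2
  subst hB0
  exact ⟨rfl, rfl, by linear_combination h⟩

/-- The kernel of the additive operator `σ² - (c⁻¹ σ c + 1) σ + c⁻¹ σ c` is spanned by
`1` and `x` over the fixed field of `σ`, where `σ x = x + c`. -/
theorem exists_fixed_coeffs_of_mem_kernel {L : Type*} [Field L] (σ : L →+* L) {x c z u : L}
    (hx : σ x = x + c) (hc : c ≠ 0) (hu : σ c = u * c)
    (hz : σ (σ z) - (u + 1) * σ z + u * z = 0) :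
    ∃ γ δ : L, σ γ = γ ∧ σ δ = δ ∧ z = γ * x + δ := by
  have hu0 : u ≠ 0 := by
    rintro rfl
    exact hc (by simpa using hu)
  have hγ : σ ((σ z - z) / c) = (σ z - z) / c := by
    rw [map_div₀, map_sub, hu]
    field_simp
    linear_combination hz
  refine ⟨(σ z - z) / c, z - (σ z - z) / c * x, hγ, ?_, by ring⟩
  rw [map_sub, map_mul, hγ, hx]
  field_simp
  ring

/-- If `τ` maps `x` to its image under a fractional linear transformation with coefficients fixed
by `σ` and `τ`, and `τ²` translates `x` by `t`, then `t = 0` or `τ` translates `x`. -/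
theorem translation_eq_zero_of_fractional_linear {L : Type*} [Field L] (σ τ : L →+* L)
    {x c t α β γ δ : L} (hfix : ∀ a, σ a = a → τ a = a)
    (hx : σ x = x + c) (hc : c ≠ 0) (hcc : c + σ c ≠ 0)
    (hxy : σ (τ x) = τ x + τ c) (hd : τ c ≠ c)
    (hα : σ α = α) (hβ : σ β = β) (hγ : σ γ = γ) (hδ : σ δ = δ) (ht : σ t = t)
    (hs : γ * x + δ ≠ 0) (hy : (γ * x + δ) * τ x = α * x + β) (hxt : τ (τ x) = x + t) :
    t = 0 := by
  have hy2 := congrArg τ hy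
  simp only [map_add, map_mul, hfix α hα, hfix β hβ, hfix γ hγ, hfix δ hδ, hxt] at hy2
  obtain ⟨hA, hB, hC⟩ := quadratic_coeffs_eq_zero_of_map_eq_add σ
    (A := γ * (α + δ)) (B := δ ^ 2 - α ^ 2 + t * (γ * (α + δ)))
    (C := t * (γ * β + δ ^ 2) - β * (α + δ)) hx hc hcc
    (by simp [hα, hγ, hδ]) (by simp [hα, hγ, hδ, ht]) (by simp [hα, hβ, hγ, hδ, ht])
    (by linear_combination (γ * x + δ) * hy2 + (α - γ * (x + t)) * hy)
  have hd0 : τ c ≠ 0 := by simpa using hc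
  by_cases hγ0 : γ = 0
  · subst hγ0
    have hδ0 : δ ≠ 0 := by simpa using hs
    have h1 : (δ - α) * (δ + α) = 0 := by linear_combination hB
    rcases mul_eq_zero.mp h1 with h2 | h2
    · exfalso
      have h3 := congrArg σ hy
      simp only [map_add, map_mul, map_zero, hα, hβ, hδ, hx, hxy] at h3
      apply hd
      apply mul_left_cancel₀ hδ0
      linear_combination h3 - hy - c * h2
    · have : t * δ ^ 2 = 0 := by linear_combination hC + β * h2
      exact (mul_eq_zero.mp this).resolve_right (pow_ne_zero _ hδ0)
  · have h2 : α + δ = 0 := (mul_eq_zero.mp hA).resolve_left hγ0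
    have h3 : t * (γ * β + δ ^ 2) = 0 := by linear_combination hC + β * h2
    refine (mul_eq_zero.mp h3).resolve_right fun h4 => hd0 ?_
    have h5 : γ * τ x + δ = 0 := by
      apply mul_left_cancel₀ hs
      linear_combination γ * hy + γ * x * h2 + h4
    have h6 := congrArg σ h5
    simp only [map_add, map_mul, map_zero, hγ, hδ, hxy] at h6
    apply mul_left_cancel₀ hγ0
    linear_combination h6 - h5

theorem pow_pow_eq_add_sum {L : Type*} [Field L] (p m : ℕ) [ExpChar L p] {x c : L}
    (hx : x ^ p ^ m = x + c) (k : ℕ) :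
    x ^ (p ^ m) ^ k = x + ∑ i ∈ Finset.range k, c ^ (p ^ m) ^ i := by
  induction k with
  | zero => simp
  | succ k ih =>
    rw [pow_succ', pow_mul, hx, ← pow_mul, add_pow_expChar_pow, pow_mul, ih,
      Finset.sum_range_succ, add_assoc]

theorem sum_pow_pow_eq_zero_of_add_eq_zero {L : Type*} [Field L] (p m : ℕ) [ExpChar L p] {c : L}
    (hp : p ≠ 0) (hc : c + c ^ p ^ m = 0) (n : ℕ) :
    ∑ i ∈ Finset.range (2 * n), c ^ (p ^ m) ^ i = 0 := by
  induction n with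
  | zero => simp
  | succ n ih =>
    rw [show 2 * (n + 1) = 2 * n + 1 + 1 by ring, Finset.sum_range_succ, Finset.sum_range_succ,
      ih, zero_add, pow_succ' _ (2 * n), pow_mul c, ← pow_mul p, ← add_pow_expChar_pow, hc,
      zero_pow (pow_ne_zero _ hp)]

theorem exists_pow_eq_add {L : Type*} [Field L] [IsAlgClosed L] {r : ℕ} (hr : 1 < r) (c : L) :
    ∃ x : L, x ^ r = x + c := by
  have hdeg : (Polynomial.X + Polynomial.C c : Polynomial L).degree < r := by
    rw [Polynomial.degree_X_add_C]
    exact_mod_cast hr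
  obtain ⟨x, hx⟩ := IsAlgClosed.exists_root
    (Polynomial.X ^ r - (Polynomial.X + Polynomial.C c) : Polynomial L) (by
      rw [Polynomial.degree_sub_eq_left_of_degree_lt (by simpa using hdeg)]
      simpa using (by omega : r ≠ 0))
  exact ⟨x, by simpa [Polynomial.IsRoot, sub_eq_zero] using hx⟩

/-- The trace vanishes as soon as the square of the invariant, with denominators cleared,
agrees at `c` and at its conjugate `c ^ q`. -/
theorem sum_pow_pow_eq_zero_of_invariant_eq {L : Type*} [Field L] [IsAlgClosed L] (p m n k : ℕ)
    [ExpChar L p] (hk : 0 < k) (hr : p ^ m = k + 1) {c : L} (hcard : c ^ (p ^ m) ^ (2 * n) = c)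
    (hd : c ^ (p ^ m) ^ n ≠ c)
    (h : (c ^ k + 1) ^ (k + 2) * (c ^ (p ^ m) ^ n) ^ ((k + 1) * k)
      = ((c ^ (p ^ m) ^ n) ^ k + 1) ^ (k + 2) * c ^ ((k + 1) * k)) :
    ∑ i ∈ Finset.range (2 * n), c ^ (p ^ m) ^ i = 0 := by
  have hp0 : p ≠ 0 := (expChar_pos L p).ne'
  have hc : c ≠ 0 := by
    rintro rfl
    exact hd (zero_pow (pow_ne_zero _ (pow_ne_zero _ hp0)))
  by_cases hck : c ^ k + 1 = 0
  · exact sum_pow_pow_eq_zero_of_add_eq_zero p m hp0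
      (by rw [hr]; linear_combination c * hck) n
  let σ : L →+* L := iterateFrobenius L p m
  let τ : L →+* L := iterateFrobenius L p (m * n)
  have hσ (a : L) : σ a = a ^ (k + 1) := by rw [← hr]; rfl
  have hτ (a : L) : τ a = a ^ (p ^ m) ^ n := by rw [← pow_mul]; rfl
  have hcomm (a : L) : σ (τ a) = τ (σ a) := by simp only [hσ, map_pow]
  have hfix (a : L) (ha : σ a = a) : τ a = a := by
    have := pow_pow_eq_add_sum p m (x := a) (c := 0) (by rw [hr, ← hσ, ha, add_zero]) n
    rw [hτ, this]
    simp [hp0]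
  obtain ⟨x, hx⟩ := exists_pow_eq_add (show 1 < k + 1 by omega) c
  rw [← hσ] at hx
  have ht : x ^ (p ^ m) ^ (2 * n) = x + ∑ i ∈ Finset.range (2 * n), c ^ (p ^ m) ^ i :=
    pow_pow_eq_add_sum p m (by rw [hr, ← hσ, hx]) _
  generalize ∑ i ∈ Finset.range (2 * n), c ^ (p ^ m) ^ i = t at ht ⊢
  have hττ (a : L) : τ (τ a) = a ^ (p ^ m) ^ (2 * n) := by
    rw [hτ, hτ, ← pow_mul, ← pow_add, two_mul]
  rw [← hττ] at ht hcard
  have htσ : σ t = t := by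
    have h1 := congrArg σ ht
    rw [hcomm, hcomm, hx, map_add, map_add, hcard, map_add, hx] at h1
    linear_combination ht - h1
  rw [← hτ] at h hd
  have hxy : σ (τ x) = τ x + τ c := by rw [hcomm, hx, map_add]
  have hdk : τ c ^ k + 1 ≠ 0 := by
    rw [← map_pow, ← map_one τ, ← map_add]
    exact (map_ne_zero τ).mpr hck
  obtain ⟨e, he⟩ := IsAlgClosed.exists_pow_nat_eq ((c ^ k + 1) / (τ c ^ k + 1)) k.succ_pos
  obtain ⟨s, hs⟩ := IsAlgClosed.exists_pow_nat_eq e hk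
  rw [eq_div_iff hdk, Nat.succ_eq_add_one] at he
  have he2 : e ^ (k + 1) * e * τ c ^ k = c ^ k := by
    apply σ.injective
    rw [hσ, hσ]
    apply mul_left_cancel₀ (pow_ne_zero (k + 2) hdk)
    rw [← pow_mul c, mul_comm k (k + 1), ← h, ← he, mul_pow _ _ (k + 2)]
    ring
  have he0 : e ≠ 0 := by
    rintro rfl
    exact pow_ne_zero k hc (by rw [← he2]; ring)
  have hs0 : s ≠ 0 := by
    rintro rfl
    exact he0 (by rw [← hs, zero_pow hk.ne'])
  have hσs : σ s = e * s := by rw [hσ, pow_succ, hs]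
  have hσd : σ (τ c) = τ c ^ k * τ c := by rw [hσ, pow_succ]
  have hker : σ (σ s) - (c ^ k + 1) * σ s + c ^ k * s = 0 := by
    rw [hσs, map_mul, hσs, hσ e]
    linear_combination e * s * he - s * he2
  have hσc : σ c = c ^ k * c := by rw [hσ, pow_succ]
  obtain ⟨γ, δ, hγ, hδ, hsx⟩ := exists_fixed_coeffs_of_mem_kernel σ hx hc hσc hker
  obtain ⟨α, β, hα, hβ, hsy⟩ := exists_fixed_coeffs_of_mem_kernel σ (z := s * τ x) hx hc hσc (by
    simp only [map_mul, map_add, hxy, hσs, hσd] at hker ⊢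
    rw [hσ e] at hker ⊢
    linear_combination τ x * hker + τ c * e * s * he)
  exact translation_eq_zero_of_fractional_linear σ τ hfix hx hc
    (fun h0 => hck (by
      apply mul_left_cancel₀ hc
      linear_combination h0 - hσc))
    hxy hd hα hβ hγ hδ htσ (hsx ▸ hs0) (hsx ▸ hsy) ht

/-- Lemma "HatRabbitEven": Let `p` be an odd prime, `r = p^m` a power of `p`, and
`q = r^n` a power of `r`.  If `c` lies in `F_{q^2}` but not in `F_q` (i.e. `c^q ≠ c`)
and `(c^(r-1) + 1)^((r+1)/2) / c^(r(r-1)/2)` lies in `F_q` (i.e. is fixed by `x ↦ x^q`),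
then the trace of `c` from `F_{q^2}` to `F_r` is zero. -/
theorem stmt_0 (p r q : ℕ) (hp : p.Prime) (hodd : Odd p)
    (m : ℕ) (hm : 0 < m) (hr : r = p ^ m)
    (n : ℕ) (hn : 0 < n) (hq : q = r ^ n)
    (K : Type*) [Field K] [Fintype K] (hK : Fintype.card K = q ^ 2)
    (c : K) (hc : c ^ q ≠ c)
    (h : ((c ^ (r - 1) + 1) ^ ((r + 1) / 2) / c ^ (r * (r - 1) / 2)) ^ q
        = (c ^ (r - 1) + 1) ^ ((r + 1) / 2) / c ^ (r * (r - 1) / 2)) :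
    ∑ i ∈ Finset.range (2 * n), c ^ r ^ i = 0 := by
  have hrodd : Odd r := hr ▸ hodd.pow
  have hr1 : 1 < r := hr ▸ Nat.one_lt_pow hm.ne' hp.one_lt
  obtain ⟨j, hj⟩ := hrodd
  have hqp : q = p ^ (m * n) := by rw [hq, hr, pow_mul]
  have : Fact p.Prime := ⟨hp⟩
  have : CharP K p := charP_of_card_eq_prime_pow (f := m * n * 2) (by
    rw [hK, hqp, ← pow_mul])
  have : ExpChar K p := ExpChar.prime hp
  have hc0 : c ≠ 0 := by
    rintro rfl
    exact hc (zero_pow (by rw [hqp]; exact pow_ne_zero _ hp.ne_zero))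
  have hcard : c ^ r ^ (2 * n) = c := by
    have := FiniteField.pow_card c
    rwa [hK, hq, ← pow_mul, mul_comm n 2] at this
  have hsum : (c ^ (2 * j) + 1) ^ q = (c ^ q) ^ (2 * j) + 1 := by
    rw [hqp, add_pow_expChar_pow, one_pow, ← pow_mul, ← pow_mul, mul_comm]
  have h1 : (2 * j + 1 + 1) / 2 = j + 1 := by omega
  have h2 : (2 * j + 1) * (2 * j) / 2 = (2 * j + 1) * j := by
    rw [mul_left_comm, Nat.mul_div_cancel_left _ two_pos]
  rw [hj, Nat.add_sub_cancel, h1, h2, div_pow, ← pow_mul _ (j + 1), mul_comm (j + 1) q, pow_mul,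
    hsum, ← pow_mul c _ q, mul_comm _ q, pow_mul c q,
    div_eq_div_iff (pow_ne_zero _ (pow_ne_zero _ hc0)) (pow_ne_zero _ hc0)] at h
  have hinv : (c ^ (2 * j) + 1) ^ (2 * j + 2) * (c ^ q) ^ ((2 * j + 1) * (2 * j))
      = ((c ^ q) ^ (2 * j) + 1) ^ (2 * j + 2) * c ^ ((2 * j + 1) * (2 * j)) := by
    have h3 := congrArg (· ^ 2) h
    simp only [mul_pow, ← pow_mul] at h3 ⊢
    ring_nf at h3 ⊢
    exact h3.symm
  let ι := algebraMap K (AlgebraicClosure K)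
  have : ExpChar (AlgebraicClosure K) p := expChar_of_injective_ringHom ι.injective p
  apply ι.injective
  have hmain := sum_pow_pow_eq_zero_of_invariant_eq p m n (2 * j) (c := ι c) (by omega)
    (by omega) (by rw [← hr, ← map_pow, hcard])
    (by rw [← hr, ← hq, ← map_pow]; exact fun h0 => hc (ι.injective h0))
    (by rw [← hr, ← hq]; simpa using congrArg ι hinv)
  rw [← hr] at hmain
  simpa using hmain
end

section
/- Let q = 3^d with d odd. Let c be an element of the field with q^2 elements that does not lie in the subfield with q elements (i.e., c^q ≠ c), such that (c^8 + 1)^5 / c^{36} lies in the subfield with q elements (i.e., is fixed by x ↦ x^q) and such that the trace of c from F_{q^2} to F_9 is nonzero. Then there exists a nonzero element c̄ of the subfield with q elements such that (c̄^8 + 1)^5 / c̄^{36} equals (c^8 + 1)^5 / c^{36} or equals −(c^8 + 1)^5 / c^{36}. -/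
open Polynomial in
/-- In an algebraically closed field of characteristic `3`, exactly nine elements are fixed by
`x ↦ x ^ 9`. -/
lemma exists_finset_pow_nine_eq_self (L : Type*) [Field L] [CharP L 3] [IsAlgClosed L] :
    ∃ A : Finset L, A.card = 9 ∧ ∀ a ∈ A, a ^ 9 = a := by
  classical
  have hsep : (X ^ 9 - X : L[X]).Separable := galois_poly_separable 3 9 (by norm_num)
  have hdeg : (X ^ 9 - X : L[X]).natDegree = 9 := by compute_degree!
  refine ⟨(X ^ 9 - X : L[X]).roots.toFinset, ?_, ?_⟩
  · rw [Multiset.toFinset_card_of_nodup (nodup_roots hsep),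
      IsAlgClosed.card_roots_eq_natDegree, hdeg]
  · intro a ha
    rw [Multiset.mem_toFinset, mem_roots'] at ha
    simpa [sub_eq_zero] using ha.2

section CharThree

variable {L : Type*} [Field L] [CharP L 3]

lemma add_pow_nine (x y : L) : (x + y) ^ 9 = x ^ 9 + y ^ 9 := by
  simpa using add_pow_char_pow x y (p := 3) (n := 2)

lemma add_pow_eighty_one (x y : L) : (x + y) ^ 81 = x ^ 81 + y ^ 81 := by
  simpa using add_pow_char_pow x y (p := 3) (n := 4)

lemma pow_eighty_one_eq_self_of_pow_forty_eq {s t : L} (hne : s ≠ t)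
    (hfix : (s - t) ^ 9 = s - t) (h : s ^ 40 = t ^ 40) : t ^ 81 = t := by
  obtain ⟨e, rfl⟩ : ∃ e, s = t + e := ⟨s - t, by ring⟩
  rw [add_sub_cancel_left] at hfix
  have he : e ≠ 0 := by
    rintro rfl
    simp at hne
  have he81 : e ^ 81 = e := by
    rw [show 81 = 9 * 9 by norm_num, pow_mul, hfix, hfix]
  have key : (t + e) ^ 81 * t = t ^ 81 * (t + e) := by
    linear_combination (t + e) * t * ((t + e) ^ 40 + t ^ 40) * h
  rw [add_pow_eighty_one, he81] at key
  apply mul_left_cancel₀ he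
  linear_combination -key

/-- The image of `(t ^ 9 - t) ^ 4` under the substitution `t ↦ -1 / t` lies in the same fibre of
`u ↦ (u ^ 2 + 1) ^ 5 / u ^ 9`. -/
lemma fibre_relation {c t : L} (hc : c ≠ 0) (ht : t ≠ 0) (h : t ^ 9 - t = c) :
    (c ^ 4) ^ 9 * ((c ^ 4 / t ^ 40) ^ 2 + 1) ^ 5 =
      ((c ^ 4) ^ 2 + 1) ^ 5 * (c ^ 4 / t ^ 40) ^ 9 := by
  have hc9 : c ^ 9 = t ^ 81 - t ^ 9 := by
    have := add_pow_nine c t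
    rw [show c + t = t ^ 9 by rw [← h]; ring] at this
    linear_combination -this
  have key : c ^ 8 + t ^ 80 = t ^ 8 * (c ^ 8 + 1) := by
    apply mul_left_cancel₀ hc
    linear_combination (1 - t ^ 8) * hc9 + (t ^ 8 - t ^ 80) * h
  have hsq : (c ^ 4 / t ^ 40) ^ 2 + 1 = t ^ 8 * (c ^ 8 + 1) / t ^ 80 := by
    rw [← key]
    field_simp
  rw [hsq]
  field_simp

open Polynomial in
lemma exists_artinSchreier_root_of_fibre [IsAlgClosed L] {b c y : L} (hc : c ≠ 0)
    (hy : y ^ 9 - y = c) (hy81 : y ^ 81 ≠ y)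
    (hbc : (c ^ 4) ^ 9 * ((b ^ 4) ^ 2 + 1) ^ 5 = ((c ^ 4) ^ 2 + 1) ^ 5 * (b ^ 4) ^ 9)
    (hne : b ^ 4 ≠ c ^ 4) : ∃ t : L, t ^ 9 - t = c ∧ b ^ 4 * t ^ 40 = c ^ 4 := by
  classical
  obtain ⟨A, hA, hfix⟩ := exists_finset_pow_nine_eq_self L
  have hroot (a : L) (ha : a ∈ A) : (y + a) ^ 9 - (y + a) = c := by
    rw [add_pow_nine, hfix a ha, ← hy]
    ring
  have h81 (a : L) (ha : a ∈ A) : (y + a) ^ 81 ≠ y + a := by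
    have ha81 : a ^ 81 = a := by
      rw [show 81 = 9 * 9 by norm_num, pow_mul, hfix a ha, hfix a ha]
    rw [add_pow_eighty_one, ha81]
    simpa using hy81
  have h0 (a : L) (ha : a ∈ A) : y + a ≠ 0 := by
    intro h
    apply h81 a ha
    simp [h]
  by_contra! hcon
  let P : L[X] := C ((c ^ 4) ^ 9) * (X ^ 2 + 1) ^ 5 - C (((c ^ 4) ^ 2 + 1) ^ 5) * X ^ 9
  have hP0 : P ≠ 0 := by
    intro h
    have := congrArg (eval 0) h
    simp [P, hc] at this
  have hdeg : P.natDegree ≤ 10 := by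
    simp only [P]
    compute_degree
  have hmem (v : L) (hv : (c ^ 4) ^ 9 * (v ^ 2 + 1) ^ 5 = ((c ^ 4) ^ 2 + 1) ^ 5 * v ^ 9) :
      v ∈ P.roots := by
    rw [mem_roots hP0]
    simp [P, hv]
  let f : L → L := fun a => c ^ 4 / (y + a) ^ 40
  have hinj : Set.InjOn f A := by
    intro a ha a' ha' h
    by_contra hne'
    have hpow : (y + a) ^ 40 = (y + a') ^ 40 := by
      have := h0 a ha
      have := h0 a' ha'
      simp only [f] at h
      field_simp at h
      exact h.symm
    refine h81 a' ha' (pow_eighty_one_eq_self_of_pow_forty_eq (by simpa using hne') ?_ hpow)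
    rw [← sub_eq_zero]
    have := add_pow_nine (a - a') a'
    rw [sub_add_cancel, hfix a ha, hfix a' ha'] at this
    rw [show y + a - (y + a') = a - a' by ring]
    linear_combination -this
  have hcnot : c ^ 4 ∉ A.image f := by
    simp only [Finset.mem_image, not_exists, not_and, f]
    intro a ha h
    have := h0 a ha
    have h40 : (y + a) ^ 40 = 1 := by
      field_simp at h
      exact h.symm
    apply h81 a ha
    linear_combination (y + a) * ((y + a) ^ 40 + 1) * h40
  have hbnot : b ^ 4 ∉ insert (c ^ 4) (A.image f) := by
    simp only [Finset.mem_insert, Finset.mem_image, not_or, not_exists, not_and, f]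
    refine ⟨hne, fun a ha h => hcon (y + a) (hroot a ha) ?_⟩
    rw [← h, div_mul_cancel₀ _ (pow_ne_zero _ (h0 a ha))]
  have hcard : (insert (b ^ 4) (insert (c ^ 4) (A.image f))).card = 11 := by
    rw [Finset.card_insert_of_notMem hbnot, Finset.card_insert_of_notMem hcnot,
      Finset.card_image_of_injOn hinj, hA]
  have hle : (insert (b ^ 4) (insert (c ^ 4) (A.image f))).card ≤ P.natDegree := by
    apply card_le_degree_of_subset_roots
    intro v hv
    rw [Finset.mem_val, Finset.mem_insert, Finset.mem_insert, Finset.mem_image] at hv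
    rcases hv with rfl | rfl | ⟨a, ha, rfl⟩
    · exact hmem _ hbc
    · exact hmem _ (mul_comm _ _)
    · exact hmem _ (fibre_relation hc (h0 a ha) (hroot a ha))
  omega

lemma pow_nine_pow_eq_self_of_artinSchreier {d : ℕ} {b c t : L} (hb : b ≠ 0) (hc : c ≠ 0)
    (hbd : b ^ 9 ^ d = b) (hcd : c ^ 9 ^ d = c) (ht : t ^ 9 - t = c)
    (h : b ^ 4 * t ^ 40 = c ^ 4) : t ^ 9 ^ d = t := by
  have hadd (x z : L) : (x + z) ^ 9 ^ d = x ^ 9 ^ d + z ^ 9 ^ d := by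
    simpa [pow_mul] using add_pow_char_pow x z (p := 3) (n := 2 * d)
  have hk : (t ^ 10) ^ 9 ^ d = t ^ 10 := by
    have h4 : (b * t ^ 10 / c) ^ 4 = 1 := by
      field_simp
      linear_combination h
    obtain ⟨m, hm⟩ : ∃ m, 9 ^ d = 4 * m + 1 := by
      have : 9 ^ d % 4 = 1 := by simp [Nat.pow_mod]
      exact ⟨9 ^ d / 4, by omega⟩
    have hfix : (b * t ^ 10 / c) ^ 9 ^ d = b * t ^ 10 / c := by
      rw [hm, pow_succ, pow_mul, h4, one_pow, one_mul]
    rw [div_pow, mul_pow, hbd, hcd] at hfix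
    field_simp at hfix
    exact hfix
  have hquad : t ^ 10 = t * (t + c) := by rw [← ht]; ring
  obtain ⟨a, ha⟩ : ∃ a, t ^ 9 ^ d = t + a := ⟨t ^ 9 ^ d - t, by ring⟩
  have ha9 : a ^ 9 = a := by
    have h9 : (t ^ 9 ^ d) ^ 9 = t ^ 9 ^ d + c := by
      rw [← pow_mul, mul_comm, pow_mul, show t ^ 9 = t + c by rw [← ht]; ring, hadd, hcd]
    rw [ha, add_pow_nine] at h9
    linear_combination h9 - ht
  have had : a ^ 9 ^ d = a := by
    have (n : ℕ) : a ^ 9 ^ n = a := by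
      induction n with
      | zero => simp
      | succ n ih => rw [pow_succ, pow_mul, ih, ha9]
    exact this d
  have hs : (t + a) * (t + a + c) = t * (t + c) := by
    rw [hquad, mul_pow, hadd, hcd, ha] at hk
    exact hk
  have hprod : a * (2 * t + a + c) = 0 := by linear_combination hs
  rcases mul_eq_zero.mp hprod with h0 | h0
  · rw [ha, h0, add_zero]
  · have hap : (2 * t + a + c) ^ 9 ^ d = 2 * t + a + c + 2 * a := by
      rw [two_mul, hadd, hadd, hadd, ha, had, hcd]
      ring
    rw [h0, zero_pow (by positivity)] at hap
    have h3 : (3 : L) = 0 := by exact_mod_cast CharP.cast_eq_zero L 3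
    have : a = 0 := by linear_combination a * h3 + hap
    rw [ha, this, add_zero]

end CharThree

lemma sum_pow_nine_pow_eq {L : Type*} [Field L] [CharP L 3] {c t : L} (ht : t ^ 9 - t = c)
    (d : ℕ) : ∑ i ∈ Finset.range d, c ^ 9 ^ i = t ^ 9 ^ d - t := by
  have hterm (i : ℕ) : c ^ 9 ^ i = t ^ 9 ^ (i + 1) - t ^ 9 ^ i := by
    have := add_pow_char_pow c t (p := 3) (n := 2 * i)
    rw [pow_mul, show c + t = t ^ 9 by rw [← ht]; ring, ← pow_mul t] at this
    norm_num at this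
    rw [pow_succ']
    linear_combination -this
  simp only [hterm]
  rw [Finset.sum_range_sub (fun i => t ^ 9 ^ i), pow_zero, pow_one]

/-- Two nonzero elements of the field with `9 ^ d` elements, `d` odd, in the same fibre of
`x ↦ (x ^ 8 + 1) ^ 5 / x ^ 36` have equal fourth powers when one of them has nonzero trace
to the field with nine elements. -/
lemma pow_four_eq_of_fibre {K : Type*} [Field K] [Fintype K] [CharP K 3] {d : ℕ} (hd : Odd d)
    (hK : Fintype.card K = 9 ^ d) {b c : K} (hb : b ≠ 0) (hc : c ≠ 0)
    (hbc : (b ^ 8 + 1) ^ 5 / b ^ 36 = (c ^ 8 + 1) ^ 5 / c ^ 36)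
    (htr : ∑ i ∈ Finset.range d, c ^ 9 ^ i ≠ 0) : b ^ 4 = c ^ 4 := by
  let φ := algebraMap K (AlgebraicClosure K)
  have hφ : Function.Injective φ := φ.injective
  have : CharP (AlgebraicClosure K) 3 := charP_of_injective_ringHom hφ 3
  have hfix (x : K) : φ x ^ 9 ^ d = φ x := by
    rw [← map_pow, ← hK, FiniteField.pow_card]
  have hφb : φ b ≠ 0 := (map_ne_zero φ).mpr hb
  have hφc : φ c ≠ 0 := (map_ne_zero φ).mpr hc
  have hrel : (c ^ 4) ^ 9 * ((b ^ 4) ^ 2 + 1) ^ 5 = ((c ^ 4) ^ 2 + 1) ^ 5 * (b ^ 4) ^ 9 := by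
    rw [div_eq_div_iff (pow_ne_zero _ hb) (pow_ne_zero _ hc)] at hbc
    linear_combination hbc
  obtain ⟨y, hy⟩ : ∃ y : AlgebraicClosure K, y ^ 9 - y = φ c := by
    have hdeg : (Polynomial.X ^ 9 - Polynomial.X - Polynomial.C (φ c)).natDegree = 9 := by
      compute_degree!
    obtain ⟨y, hy⟩ := IsAlgClosed.exists_root
      (Polynomial.X ^ 9 - Polynomial.X - Polynomial.C (φ c))
      (fun h => by have := Polynomial.natDegree_eq_zero_iff_degree_le_zero.mpr h.le; omega)
    exact ⟨y, by simpa [Polynomial.IsRoot, sub_eq_zero] using hy⟩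
  have hy81 : y ^ 81 ≠ y := by
    intro h
    have hc9 : φ c ^ 9 = -φ c := by
      have := add_pow_nine (φ c) y
      rw [show φ c + y = y ^ 9 by rw [← hy]; ring] at this
      linear_combination h - this - hy
    have hiter (n : ℕ) : φ c ^ 9 ^ n = (-1) ^ n * φ c := by
      induction n with
      | zero => simp
      | succ n ih =>
        rw [pow_succ, pow_mul, ih, mul_pow, hc9, ← pow_mul, mul_comm n, pow_mul]
        norm_num [pow_succ]
    have hneg := hfix c
    rw [hiter, hd.neg_one_pow] at hneg
    have h3 : (3 : AlgebraicClosure K) = 0 := by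
      exact_mod_cast CharP.cast_eq_zero (AlgebraicClosure K) 3
    apply hφc
    linear_combination φ c * h3 + hneg
  by_contra hne
  obtain ⟨t, ht, hbt⟩ := exists_artinSchreier_root_of_fibre (b := φ b) hφc hy hy81
    (by simpa using congrArg φ hrel)
    (fun h => hne (hφ (by simpa using h)))
  apply htr
  apply hφ
  rw [map_sum, map_zero]
  simp only [map_pow]
  rw [sum_pow_nine_pow_eq ht, sub_eq_zero]
  exact pow_nine_pow_eq_self_of_artinSchreier hφb hφc (hfix b) (hfix c) ht hbt

/-- Lemma "HatRabbitOdd": Let `q = 3^d` with `d` odd.  If `c ∈ F_{q^2} \ F_q` satisfies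
`(c^8+1)^5 / c^36 ∈ F_q` and `Tr_{F_{q^2}/F_9}(c) ≠ 0`, then there is a nonzero
`c̄ ∈ F_q` with `(c̄^8+1)^5 / c̄^36 = ± (c^8+1)^5 / c^36`. -/
theorem stmt_2 (d : ℕ) (hd : Odd d) (q : ℕ) (hq : q = 3 ^ d)
    (K : Type*) [Field K] [Fintype K] (hK : Fintype.card K = q ^ 2)
    (c : K) (hc : c ^ q ≠ c)
    (h1 : ((c ^ 8 + 1) ^ 5 / c ^ 36) ^ q = (c ^ 8 + 1) ^ 5 / c ^ 36)
    (h2 : ∑ i ∈ Finset.range d, c ^ 9 ^ i ≠ 0) :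
    ∃ cb : K, cb ≠ 0 ∧ cb ^ q = cb ∧
      ((cb ^ 8 + 1) ^ 5 / cb ^ 36 = (c ^ 8 + 1) ^ 5 / c ^ 36 ∨
        (cb ^ 8 + 1) ^ 5 / cb ^ 36 = -((c ^ 8 + 1) ^ 5 / c ^ 36)) := by
  have hK9 : Fintype.card K = 9 ^ d := by
    rw [hK, hq, ← pow_mul, mul_comm, pow_mul]
    norm_num
  have : CharP K 3 := by
    have : Fact (Nat.Prime 3) := ⟨by norm_num⟩
    exact charP_of_card_eq_prime_pow (f := d * 2) (by rw [hK, hq, ← pow_mul])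
  have hq0 : q ≠ 0 := by rw [hq]; positivity
  have hc0 : c ≠ 0 := by
    rintro rfl
    simp [hq0] at hc
  have hadd (x z : K) : (x + z) ^ q = x ^ q + z ^ q := by
    rw [hq]
    exact add_pow_char_pow x z 3 d
  have hfour : (c ^ q) ^ 4 = c ^ 4 := by
    refine pow_four_eq_of_fibre hd hK9 (pow_ne_zero _ hc0) hc0 ?_ h2
    rw [div_pow] at h1
    rw [← h1, ← pow_mul _ 5, mul_comm 5, pow_mul, hadd, one_pow]
    ring
  have hqmod : q % 4 = 3 := by
    obtain ⟨k, rfl⟩ := hd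
    rw [hq, pow_succ, pow_mul, Nat.mul_mod, Nat.pow_mod]
    norm_num
  obtain ⟨i, hi⟩ : ∃ i : K, i ^ 2 = -1 := by
    have : IsSquare (-1 : K) := by
      rw [FiniteField.isSquare_neg_one_iff, hK9, Nat.pow_mod]
      norm_num
    obtain ⟨i, hi⟩ := this
    exact ⟨i, by rw [hi, sq]⟩
  have hiq : i ^ q = -i := by
    rw [← Nat.div_add_mod q 4, hqmod, pow_add, pow_mul,
      show i ^ 4 = 1 by linear_combination (i ^ 2 - 1) * hi, one_pow]
    linear_combination i * hi
  have hi0 : i ≠ 0 := by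
    rintro rfl
    simp at hi
  have h3 : (3 : K) = 0 := by exact_mod_cast CharP.cast_eq_zero K 3
  have hoddq : Odd q := by
    rw [Nat.odd_iff]
    omega
  have hpos (η : K) (hη : η ^ 4 = 1) :
      ((η * c) ^ 8 + 1) ^ 5 / (η * c) ^ 36 = (c ^ 8 + 1) ^ 5 / c ^ 36 := by
    rw [mul_pow, mul_pow, show 8 = 4 * 2 by norm_num, show 36 = 4 * 9 by norm_num, pow_mul η,
      pow_mul η, hη]
    norm_num
  have hneg (η : K) (hη : η ^ 4 = -1) :
      ((η * c) ^ 8 + 1) ^ 5 / (η * c) ^ 36 = -((c ^ 8 + 1) ^ 5 / c ^ 36) := by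
    rw [mul_pow, mul_pow, show 8 = 4 * 2 by norm_num, show 36 = 4 * 9 by norm_num, pow_mul η,
      pow_mul η, hη, show (-1 : K) ^ 2 = 1 by norm_num, show (-1 : K) ^ 9 = -1 by norm_num,
      one_mul, neg_one_mul, div_neg]
  have hne_zero (η : K) (hη : η ^ 4 = -1) : η ≠ 0 := by
    rintro rfl
    simp at hη
  have hfac : (c ^ q - c) * ((c ^ q + c) * ((c ^ q - i * c) * (c ^ q + i * c))) = 0 := by
    linear_combination hfour - ((c ^ q) ^ 2 - c ^ 2) * c ^ 2 * hi
  rcases mul_eq_zero.mp hfac with h | h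
  · exact absurd (sub_eq_zero.mp h) hc
  rcases mul_eq_zero.mp h with h | h
  · refine ⟨i * c, mul_ne_zero hi0 hc0, ?_, Or.inl (hpos i ?_)⟩
    · rw [mul_pow, hiq]
      linear_combination -i * h
    · linear_combination (i ^ 2 - 1) * hi
  rcases mul_eq_zero.mp h with h | h
  · have hη : (1 + i) ^ 4 = -1 := by
      linear_combination (i ^ 2 + 4 * i + 5) * hi - h3
    refine ⟨(1 + i) * c, mul_ne_zero (hne_zero _ hη) hc0, ?_, Or.inr (hneg _ hη)⟩
    rw [mul_pow, hadd, one_pow, hiq]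
    linear_combination (1 - i) * h - c * hi
  · have hη : (1 + -i) ^ 4 = -1 := by
      linear_combination (i ^ 2 - 4 * i + 5) * hi - h3
    refine ⟨(1 + -i) * c, mul_ne_zero (hne_zero _ hη) hc0, ?_, Or.inr (hneg _ hη)⟩
    rw [mul_pow, hadd, one_pow, hoddq.neg_pow, hiq]
    linear_combination (1 + i) * h - c * hi
end

section
/- Let p be an odd prime and r a power of p. Let K be a field containing F_r, let a, b, c, d be elements of F_r with ad − bc = 1, and let z ∈ K satisfy z^r ≠ z and cz + d ≠ 0. Set w = (az + b)/(cz + d). Then w^r ≠ w and F(w) = F(z), i.e., (w^{r^2} − w)^{(r+1)/2} / (w^r − w)^{(r^2+1)/2} = (z^{r^2} − z)^{(r+1)/2} / (z^r − z)^{(r^2+1)/2}. -/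
/-- If `q` is a power of the characteristic and `a, b, c, d` are fixed by `x ↦ x ^ q`, then
`w = (a z + b) / (c z + d)` satisfies `w ^ q - w = (a d - b c) (z ^ q - z) / (c z + d) ^ (q + 1)`. -/
theorem moebius_pow_sub_self {K : Type*} [Field K] {p : ℕ} [Fact p.Prime] [CharP K p] (n : ℕ)
    {a b c d z : K} (ha : a ^ p ^ n = a) (hb : b ^ p ^ n = b) (hc : c ^ p ^ n = c)
    (hd : d ^ p ^ n = d) (hden : c * z + d ≠ 0) :
    ((a * z + b) / (c * z + d)) ^ p ^ n - (a * z + b) / (c * z + d)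
      = (a * d - b * c) * (z ^ p ^ n - z) / (c * z + d) ^ (p ^ n + 1) := by
  have hj : (c * z + d) ^ p ^ n = c * z ^ p ^ n + d := by
    rw [add_pow_char_pow, mul_pow, hc, hd]
  have hj0 : c * z ^ p ^ n + d ≠ 0 := hj ▸ pow_ne_zero _ hden
  rw [div_pow, add_pow_char_pow, mul_pow, ha, hb, pow_succ, hj, div_sub_div _ _ hj0 hden]
  congr 1
  ring

/-- The rational function `F(z) = (z^(r^2) - z)^((r+1)/2) / (z^r - z)^((r^2+1)/2)` is
invariant under fractional linear transformations with coefficients in `F_r` of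
determinant 1, and these transformations preserve the condition `z^r ≠ z`. -/
theorem stmt_3 (p r : ℕ) (hp : p.Prime) (hodd : Odd p)
    (m : ℕ) (hm : 0 < m) (hr : r = p ^ m)
    (K : Type*) [Field K] [CharP K p]
    (a b c d : K) (ha : a ^ r = a) (hb : b ^ r = b) (hc : c ^ r = c) (hd : d ^ r = d)
    (hdet : a * d - b * c = 1)
    (z : K) (hz : z ^ r ≠ z) (hden : c * z + d ≠ 0) :
    ((a * z + b) / (c * z + d)) ^ r ≠ (a * z + b) / (c * z + d) ∧
    (((a * z + b) / (c * z + d)) ^ r ^ 2 - (a * z + b) / (c * z + d)) ^ ((r + 1) / 2)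
        / (((a * z + b) / (c * z + d)) ^ r - (a * z + b) / (c * z + d)) ^ ((r ^ 2 + 1) / 2)
      = (z ^ r ^ 2 - z) ^ ((r + 1) / 2) / (z ^ r - z) ^ ((r ^ 2 + 1) / 2) := by
  have : Fact p.Prime := ⟨hp⟩
  have sq_fixed {x : K} (hx : x ^ r = x) : x ^ r ^ 2 = x := by rw [sq, pow_mul, hx, hx]
  have hr2 : r ^ 2 = p ^ (m * 2) := by rw [hr, pow_mul]
  have h1 : ((a * z + b) / (c * z + d)) ^ r - (a * z + b) / (c * z + d)
      = (z ^ r - z) / (c * z + d) ^ (r + 1) := by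
    rw [hr] at ha hb hc hd ⊢
    rw [moebius_pow_sub_self m ha hb hc hd hden, hdet, one_mul]
  have h2 : ((a * z + b) / (c * z + d)) ^ r ^ 2 - (a * z + b) / (c * z + d)
      = (z ^ r ^ 2 - z) / (c * z + d) ^ (r ^ 2 + 1) := by
    have ha2 := sq_fixed ha
    have hb2 := sq_fixed hb
    have hc2 := sq_fixed hc
    have hd2 := sq_fixed hd
    rw [hr2] at ha2 hb2 hc2 hd2 ⊢
    rw [moebius_pow_sub_self (m * 2) ha2 hb2 hc2 hd2 hden, hdet, one_mul]
  refine ⟨fun h => ?_, ?_⟩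
  · rw [h, sub_self] at h1
    exact div_ne_zero (sub_ne_zero.mpr hz) (pow_ne_zero _ hden) h1.symm
  · have hrodd : Odd r := hr ▸ hodd.pow
    have hexp : (r ^ 2 + 1) * ((r + 1) / 2) = (r + 1) * ((r ^ 2 + 1) / 2) := by
      rw [← Nat.mul_div_assoc _ hrodd.add_one.two_dvd,
        ← Nat.mul_div_assoc _ hrodd.pow.add_one.two_dvd, mul_comm]
    rw [h1, h2, div_pow, div_pow, ← pow_mul, ← pow_mul, hexp,
      div_div_div_cancel_right₀ (pow_ne_zero _ hden)]
end

section
/- Let p be an odd prime and r a power of p, and let K be a field containing F_r. For every nonzero element e of K, the polynomial ((X^r − X)^{r-1} + 1)^{(r+1)/2} − e·(X^r − X)^{r(r-1)/2} in K[X] is separable. -/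
open Polynomial in
/-- If `Y' = -1` and `r = 0`, `2 a = 1`, `b = 0` in `K`, then
`(Y^(r-1) + 1)^a - e Y^b` is separable, as its derivative is `a (Y^(r-1) + 1)^(a-1) Y^(r-2)`. -/
theorem separable_pow_add_one_pow_sub_C_mul_pow {K : Type*} [Field K] {Y : K[X]}
    (hY : derivative Y = -1) {e : K} (he : e ≠ 0) {r a b : ℕ} (hr : 2 ≤ r) (hrK : (r : K) = 0)
    (ha : a ≠ 0) (haK : (a : K) ≠ 0) (hb : b ≠ 0) (hbK : (b : K) = 0) :
    ((Y ^ (r - 1) + 1) ^ a - C e * Y ^ b).Separable := by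
  have hder : derivative ((Y ^ (r - 1) + 1) ^ a - C e * Y ^ b)
      = C (a : K) * ((Y ^ (r - 1) + 1) ^ (a - 1) * Y ^ (r - 1 - 1)) := by
    have h1 : ((r - 1 : ℕ) : K) = -1 := by
      rw [Nat.cast_sub (by omega), hrK]
      simp
    simp [derivative_pow, hY, h1, hbK]
    ring
  have hcop : IsCoprime (Y ^ (r - 1) + 1) Y := by
    refine ⟨1, -Y ^ (r - 1 - 1), ?_⟩
    have : Y ^ (r - 1) = Y ^ (r - 1 - 1) * Y := by
      rw [← pow_succ]
      congr 1
      omega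
    rw [this]
    ring
  have hunit : IsUnit (C e) := isUnit_C.2 he.isUnit
  have hA : IsCoprime ((Y ^ (r - 1) + 1) ^ a - C e * Y ^ b) (Y ^ (r - 1) + 1) := by
    obtain ⟨c, hc⟩ := dvd_pow_self (Y ^ (r - 1) + 1) ha
    have h : IsCoprime (-(C e * Y ^ b)) (Y ^ (r - 1) + 1) :=
      ((isCoprime_mul_unit_left_left hunit _ _).2 hcop.symm.pow_left).neg_left
    have := h.add_mul_left_left c
    rwa [← hc, neg_add_eq_sub] at this
  have hB : IsCoprime ((Y ^ (r - 1) + 1) ^ a - C e * Y ^ b) Y := by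
    obtain ⟨c, hc⟩ := dvd_pow_self Y hb
    have h : IsCoprime ((Y ^ (r - 1) + 1) ^ a) Y := hcop.pow_left
    have := h.add_mul_left_left (-(C e * c))
    rwa [mul_neg, mul_left_comm, ← hc, ← sub_eq_add_neg] at this
  rw [separable_def, hder]
  exact (isCoprime_mul_unit_left_right (isUnit_C.2 haK.isUnit) _ _).2
    (hA.pow_right.mul_right hB.pow_right)

/-- For `r` a power of an odd prime `p`, a field `K` of characteristic `p`, and a
nonzero `e ∈ K`, the polynomial `((X^r - X)^(r-1) + 1)^((r+1)/2) - e (X^r - X)^(r(r-1)/2)`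
is separable. -/
theorem stmt_4 (p r : ℕ) (hp : p.Prime) (hodd : Odd p)
    (m : ℕ) (hm : 0 < m) (hr : r = p ^ m)
    (K : Type*) [Field K] [CharP K p]
    (e : K) (he : e ≠ 0) :
    (((Polynomial.X ^ r - Polynomial.X) ^ (r - 1) + 1) ^ ((r + 1) / 2)
      - Polynomial.C e * (Polynomial.X ^ r - Polynomial.X) ^ (r * (r - 1) / 2)
      : Polynomial K).Separable := by
  have hrK : (r : K) = 0 := by
    rw [hr, Nat.cast_pow, CharP.cast_eq_zero, zero_pow hm.ne']
  have hr2 : 2 ≤ r := by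
    rw [hr]
    exact hp.two_le.trans (Nat.le_self_pow hm.ne' p)
  obtain ⟨k, hk⟩ : Odd r := hr ▸ hodd.pow
  have ha : (r + 1) / 2 = k + 1 := by omega
  have hb : r * (r - 1) / 2 = r * k := by
    rw [show r - 1 = k * 2 by omega, ← mul_assoc, Nat.mul_div_cancel _ two_pos]
  rw [ha, hb]
  refine separable_pow_add_one_pow_sub_C_mul_pow ?_ he hr2 hrK k.succ_ne_zero ?_
    (Nat.mul_ne_zero (by omega) (by omega)) ?_
  · simp [Polynomial.derivative_X_pow, hrK]
  · intro h
    have h2 : (r : K) + 1 = 2 * ((k + 1 : ℕ) : K) := by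
      rw [hk]
      push_cast
      ring
    rw [h, hrK] at h2
    simp at h2
  · rw [Nat.cast_mul, hrK, zero_mul]
end

section
/- Let p be an odd prime and r a power of p, and let K be an algebraically closed field containing F_r. Let z₀ ∈ K satisfy z₀^{r^2} ≠ z₀ (so that F(z₀) is defined and nonzero). Then the set of roots in K of the polynomial ((X^r − X)^{r-1} + 1)^{(r+1)/2} − F(z₀)·(X^r − X)^{r(r-1)/2} is exactly the set { (a z₀ + b)/(c z₀ + d) : a, b, c, d ∈ F_r with ad − bc = 1 }, the orbit of z₀ under the action of PSL₂(F_r) by fractional linear transformations. -/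
/-- In an algebraically closed field, `g ^ (2 * (k + 1))` and `g ^ (2 * ((2 * k + 1) * k))` can be
prescribed simultaneously as soon as the prescribed values are compatible. -/
lemma exists_pow_eq_and_pow_eq {K : Type*} [Field K] [IsAlgClosed K] (k : ℕ) (hk : 0 < k)
    {q s : K} (hq : q ≠ 0) (hs : s ≠ 0) (h : s ^ (k + 1) = q ^ ((2 * k + 1) * k)) :
    ∃ g : K, g ≠ 0 ∧ g ^ (2 * (k + 1)) = q ∧ g ^ (2 * ((2 * k + 1) * k)) = s := by
  obtain ⟨g, hg⟩ := IsAlgClosed.exists_pow_nat_eq q (n := 2 * (k + 1)) (by omega)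
  have hg0 : g ≠ 0 := by
    rintro rfl
    exact hq (by rw [← hg]; simp)
  obtain ⟨η, hη⟩ := IsAlgClosed.exists_pow_nat_eq (s / g ^ (2 * ((2 * k + 1) * k))) (n := 2)
    (by omega)
  have hη1 : η ^ (2 * (k + 1)) = 1 := by
    rw [pow_mul, hη, div_pow, h, ← hg, ← pow_mul, ← pow_mul]
    rw [show 2 * (k + 1) * ((2 * k + 1) * k) = 2 * ((2 * k + 1) * k) * (k + 1) by ring]
    exact div_self (pow_ne_zero _ hg0)
  have hη0 : η ≠ 0 := by
    rintro rfl
    simp at hη1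
  refine ⟨η * g, mul_ne_zero hη0 hg0, by rw [mul_pow, hη1, hg, one_mul], ?_⟩
  have hη2 : η ^ (2 * ((2 * k + 1) * k)) = η ^ 2 := by
    obtain ⟨j, rfl⟩ : ∃ j, k = j + 1 := ⟨k - 1, by omega⟩
    rw [show 2 * ((2 * (j + 1) + 1) * (j + 1)) = 2 * (j + 1 + 1) * (2 * j + 1) + 2 by ring,
      pow_add, pow_mul, hη1, one_pow, one_mul]
  rw [mul_pow, hη2, hη]
  field_simp

/-- Solutions of the second order `φ`-linear equation satisfied by `1` and `z` are the
combinations of `1` and `z` with coefficients fixed by `φ`. -/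
lemma exists_fixed_eq_mul_add {K : Type*} [Field K] (φ : K →+* K) {z t : K} (hz : φ z ≠ z)
    (ht : φ (φ t) * (φ z - z) = (φ (φ z) - z) * φ t - (φ (φ z) - φ z) * t) :
    ∃ a b : K, φ a = a ∧ φ b = b ∧ t = a * z + b := by
  have hu : φ z - z ≠ 0 := sub_ne_zero.2 hz
  have hv : φ (φ z) - φ z ≠ 0 := by
    rw [← map_sub]
    exact (map_ne_zero φ).2 hu
  have ha : φ ((φ t - t) / (φ z - z)) = (φ t - t) / (φ z - z) := by
    rw [map_div₀, map_sub, map_sub, div_eq_div_iff hv hu]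
    linear_combination ht
  refine ⟨(φ t - t) / (φ z - z), t - (φ t - t) / (φ z - z) * z, ha, ?_, by ring⟩
  rw [map_sub, map_mul, ha]
  field_simp
  ring

/-- If `x` and `z` have the same invariants up to rescaling by `g`, then they are related by a
fractional linear transformation of determinant one with coefficients fixed by `φ`. -/
lemma exists_fixed_eq_div {K : Type*} [Field K] (φ : K →+* K) {x z g : K} (hg : g ≠ 0)
    (hz : φ z ≠ z) (hx : φ x ≠ x)
    (hgu : g * φ g * (φ x - x) = φ z - z)
    (hgw : φ (φ g) * ((φ (φ x) - x) * (φ z - z)) = φ g * ((φ (φ z) - z) * (φ x - x))) :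
    ∃ a b c d : K, φ a = a ∧ φ b = b ∧ φ c = c ∧ φ d = d ∧
      a * d - b * c = 1 ∧ x = (a * z + b) / (c * z + d) := by
  have hux : φ x - x ≠ 0 := sub_ne_zero.2 hx
  have huz : φ z - z ≠ 0 := sub_ne_zero.2 hz
  have hgv : φ g * φ (φ g) * (φ (φ x) - φ x) = φ (φ z) - φ z := by
    simpa using congrArg φ hgu
  have hg2 : φ (φ g) * (φ z - z) * (φ x - x) =
      ((φ (φ z) - z) * φ g - (φ (φ z) - φ z) * g) * (φ x - x) := by
    linear_combination hgw + φ (φ g) * (φ (φ x) - φ x) * hgu - g * (φ x - x) * hgv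
  have hxg2 : φ (φ (x * g)) * (φ z - z) * (φ x - x) =
      ((φ (φ z) - z) * φ (x * g) - (φ (φ z) - φ z) * (x * g)) * (φ x - x) := by
    simp only [map_mul]
    linear_combination φ x * hgw - x * g * (φ x - x) * hgv +
      x * φ (φ g) * (φ (φ x) - φ x) * hgu
  obtain ⟨a, b, ha, hb, hab⟩ := exists_fixed_eq_mul_add φ hz (mul_right_cancel₀ hux hxg2)
  obtain ⟨c, d, hc, hd, hcd⟩ := exists_fixed_eq_mul_add φ hz (mul_right_cancel₀ hux hg2)
  refine ⟨a, b, c, d, ha, hb, hc, hd, ?_, ?_⟩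
  · have h1 : φ x * φ g = a * φ z + b := by
      simpa [ha, hb] using congrArg φ hab
    have h2 : φ g = c * φ z + d := by
      simpa [hc, hd] using congrArg φ hcd
    apply mul_right_cancel₀ huz
    linear_combination hgu - g * h1 - (a * φ z + b) * hcd + φ g * hab + (a * z + b) * h2
  · rw [← hab, ← hcd, mul_div_cancel_right₀ _ hg]

/-- The denominator of a fractional linear transformation with coefficients fixed by `φ` does not
vanish at a point not fixed by `φ`. -/
lemma mul_add_ne_zero_of_fixed {K : Type*} [Field K] (φ : K →+* K) {z a b c d : K} (hz : φ z ≠ z)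
    (hc : φ c = c) (hd : φ d = d) (hdet : a * d - b * c = 1) : c * z + d ≠ 0 := by
  intro h
  have h' : c * φ z + d = 0 := by
    simpa [hc, hd] using congrArg φ h
  have hc0 : c = 0 := by
    have : c * (φ z - z) = 0 := by linear_combination h' - h
    exact (mul_eq_zero.1 this).resolve_right (sub_ne_zero.2 hz)
  have hd0 : d = 0 := by simpa [hc0] using h
  simp [hc0, hd0] at hdet

/-- The orbit polynomial vanishes at `x` exactly when `x` is not fixed by `φ` and the invariant
takes the same value at `x` and at `z`, written without denominators. -/
lemma orbit_polynomial_eq_zero_iff {K : Type*} [Field K] (φ : K →+* K) {k : ℕ} (hk : 0 < k)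
    (hφ : ∀ y, φ y = y ^ (2 * k + 1)) {x z : K} (hz : φ z ≠ z) :
    (((φ x - x) ^ (2 * k) + 1) ^ (k + 1) -
      ((φ (φ z) - z) ^ (k + 1) / (φ z - z) ^ (k + 1 + (2 * k + 1) * k)) *
        (φ x - x) ^ ((2 * k + 1) * k) = 0) ↔
    φ x ≠ x ∧ (φ (φ x) - x) ^ (k + 1) * (φ z - z) ^ (k + 1 + (2 * k + 1) * k) =
      (φ (φ z) - z) ^ (k + 1) * (φ x - x) ^ (k + 1 + (2 * k + 1) * k) := by
  have huz : φ z - z ≠ 0 := sub_ne_zero.2 hz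
  by_cases hx : φ x = x
  · have : (2 * k + 1) * k ≠ 0 := by positivity
    simp [hx, hk.ne', this]
  have hux : φ x - x ≠ 0 := sub_ne_zero.2 hx
  have hw : (φ x - x) ^ (2 * k) + 1 = (φ (φ x) - x) / (φ x - x) := by
    have h : φ (φ x) - φ x = (φ x - x) ^ (2 * k) * (φ x - x) := by
      rw [← map_sub, hφ (φ x - x), pow_succ]
    rw [eq_div_iff hux]
    linear_combination -h
  rw [hw, sub_eq_zero, div_pow, div_mul_eq_mul_div,
    div_eq_div_iff (pow_ne_zero _ hux) (pow_ne_zero _ huz), mul_assoc _ ((φ x - x) ^ _),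
    ← pow_add, add_comm ((2 * k + 1) * k)]
  simp [hx]

/-- Two points at which the invariant agrees are related by a fractional linear transformation of
determinant one with coefficients fixed by `φ`. -/
lemma exists_fixed_eq_div_of_invariant_eq {K : Type*} [Field K] [IsAlgClosed K] (φ : K →+* K)
    {k : ℕ} (hk : 0 < k) (hφ : ∀ y, φ y = y ^ (2 * k + 1)) {x z : K} (hz : φ z ≠ z)
    (hx : φ x ≠ x) (hz2 : φ (φ z) ≠ z)
    (h : (φ (φ x) - x) ^ (k + 1) * (φ z - z) ^ (k + 1 + (2 * k + 1) * k) =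
      (φ (φ z) - z) ^ (k + 1) * (φ x - x) ^ (k + 1 + (2 * k + 1) * k)) :
    ∃ a b c d : K, φ a = a ∧ φ b = b ∧ φ c = c ∧ φ d = d ∧
      a * d - b * c = 1 ∧ x = (a * z + b) / (c * z + d) := by
  have hux : φ x - x ≠ 0 := sub_ne_zero.2 hx
  have huz : φ z - z ≠ 0 := sub_ne_zero.2 hz
  have hwz : φ (φ z) - z ≠ 0 := sub_ne_zero.2 hz2
  have hwx : φ (φ x) - x ≠ 0 := by
    intro h0
    rw [h0, zero_pow k.succ_ne_zero, zero_mul] at h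
    exact mul_ne_zero (pow_ne_zero _ hwz) (pow_ne_zero _ hux) h.symm
  obtain ⟨g, hg, hgq, hgs⟩ := exists_pow_eq_and_pow_eq k hk
    (q := (φ z - z) / (φ x - x))
    (s := (φ (φ z) - z) * (φ x - x) / ((φ (φ x) - x) * (φ z - z)))
    (div_ne_zero huz hux) (div_ne_zero (mul_ne_zero hwz hux) (mul_ne_zero hwx huz)) (by
      rw [div_pow, div_pow, div_eq_div_iff (pow_ne_zero _ (mul_ne_zero hwx huz))
        (pow_ne_zero _ hux), mul_pow, mul_pow]
      rw [pow_add, pow_add] at h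
      linear_combination -h)
  refine exists_fixed_eq_div φ hg hz hx ?_ ?_
  · rw [eq_div_iff hux] at hgq
    rw [← hgq, hφ g]
    ring
  · rw [eq_div_iff (mul_ne_zero hwx huz)] at hgs
    rw [← hgs, hφ (φ g), hφ g]
    ring

/-- Fractional linear transformations of determinant one with coefficients fixed by `φ` preserve
the invariant. -/
lemma invariant_eq_of_fixed_eq_div {K : Type*} [Field K] (φ : K →+* K)
    {k : ℕ} (hφ : ∀ y, φ y = y ^ (2 * k + 1)) {z a b c d : K} (hz : φ z ≠ z)
    (ha : φ a = a) (hb : φ b = b) (hc : φ c = c) (hd : φ d = d) (hdet : a * d - b * c = 1)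
    {x : K} (hx : x = (a * z + b) / (c * z + d)) :
    φ x ≠ x ∧ (φ (φ x) - x) ^ (k + 1) * (φ z - z) ^ (k + 1 + (2 * k + 1) * k) =
      (φ (φ z) - z) ^ (k + 1) * (φ x - x) ^ (k + 1 + (2 * k + 1) * k) := by
  have hL : c * z + d ≠ 0 := mul_add_ne_zero_of_fixed φ hz hc hd hdet
  generalize hLdef : c * z + d = L at hx hL
  have h0 : L * x = a * z + b := by rw [hx, mul_div_cancel₀ _ hL]
  have h1 : φ L * φ x = a * φ z + b := by simpa [ha, hb] using congrArg φ h0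
  have h2 : φ (φ L) * φ (φ x) = a * φ (φ z) + b := by simpa [ha, hb] using congrArg φ h1
  have hL1 : c * φ z + d = φ L := by simpa [hc, hd] using congrArg φ hLdef
  have hL2 : c * φ (φ z) + d = φ (φ L) := by simpa [hc, hd] using congrArg φ hL1
  have hu : φ z - z = L * φ L * (φ x - x) := by
    linear_combination -(φ z - z) * hdet - L * h1 + φ L * h0 +
      (a * φ z + b) * hLdef - (a * z + b) * hL1
  have hw : φ (φ z) - z = L * φ (φ L) * (φ (φ x) - x) := by
    linear_combination -(φ (φ z) - z) * hdet - L * h2 + φ (φ L) * h0 +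
      (a * φ (φ z) + b) * hLdef - (a * z + b) * hL2
  refine ⟨fun h => sub_ne_zero.2 hz (by rw [hu, h, sub_self, mul_zero]), ?_⟩
  have hpow : (L * φ L) ^ (k + 1 + (2 * k + 1) * k) = (L * φ (φ L)) ^ (k + 1) := by
    rw [hφ (φ L), hφ L]
    ring
  rw [hu, hw, mul_pow (L * φ L), mul_pow (L * φ (φ L)), hpow]
  ring

/-- For `r` a power of an odd prime `p` and `K` an algebraically closed field of
characteristic `p`, if `z₀ ∈ K` satisfies `z₀^(r^2) ≠ z₀`, then the roots of
`((X^r - X)^(r-1) + 1)^((r+1)/2) - F(z₀) (X^r - X)^(r(r-1)/2)` are exactly the orbit of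
`z₀` under `PSL₂(F_r)` acting by fractional linear transformations. -/
theorem stmt_5 (p r : ℕ) (hp : p.Prime) (hodd : Odd p)
    (m : ℕ) (hm : 0 < m) (hr : r = p ^ m)
    (K : Type*) [Field K] [IsAlgClosed K] [CharP K p]
    (z₀ : K) (hz₀ : z₀ ^ r ^ 2 ≠ z₀) :
    {x : K | ((x ^ r - x) ^ (r - 1) + 1) ^ ((r + 1) / 2)
        - ((z₀ ^ r ^ 2 - z₀) ^ ((r + 1) / 2) / (z₀ ^ r - z₀) ^ ((r ^ 2 + 1) / 2))
            * (x ^ r - x) ^ (r * (r - 1) / 2) = 0}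
      = {x : K | ∃ a b c d : K, a ^ r = a ∧ b ^ r = b ∧ c ^ r = c ∧ d ^ r = d ∧
          a * d - b * c = 1 ∧ x = (a * z₀ + b) / (c * z₀ + d)} := by
  obtain ⟨φ, hφ⟩ : ∃ φ : K →+* K, ∀ y, φ y = y ^ r := by
    have : Fact p.Prime := ⟨hp⟩
    exact ⟨iterateFrobenius K p m, fun y => by rw [iterateFrobenius_def, hr]⟩
  have hφ2 : ∀ y : K, y ^ r ^ 2 = φ (φ y) := fun y => by rw [hφ, hφ, sq, pow_mul]
  have hr_odd : Odd r := hr ▸ hodd.pow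
  have hr_gt : 1 < r := hr ▸ Nat.one_lt_pow hm.ne' hp.one_lt
  obtain ⟨k, rfl⟩ := hr_odd
  have hk : 0 < k := by omega
  rw [hφ2] at hz₀
  have hz : φ z₀ ≠ z₀ := fun h => hz₀ (by rw [h, h])
  have e1 : (2 * k + 1 + 1) / 2 = k + 1 := by omega
  have e2 : ((2 * k + 1) ^ 2 + 1) / 2 = k + 1 + (2 * k + 1) * k := by
    rw [show (2 * k + 1) ^ 2 + 1 = 2 * (k + 1 + (2 * k + 1) * k) by ring]
    omega
  have e3 : (2 * k + 1) * (2 * k) / 2 = (2 * k + 1) * k := by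
    rw [show (2 * k + 1) * (2 * k) = 2 * ((2 * k + 1) * k) by ring]
    omega
  ext x
  simp only [Set.mem_ofPred_eq, hφ2, e1, e2, e3, Nat.add_sub_cancel]
  simp only [← hφ]
  rw [orbit_polynomial_eq_zero_iff φ hk hφ hz]
  constructor
  · rintro ⟨hx, h⟩
    exact exists_fixed_eq_div_of_invariant_eq φ hk hφ hz hx hz₀ h
  · rintro ⟨a, b, c, d, ha, hb, hc, hd, hdet, hx⟩
    exact invariant_eq_of_fixed_eq_div φ hφ hz ha hb hc hd hdet hx
end

section
/- Let p be an odd prime and let r be a power of p. Then the group PSL₂(F_r) contains no element of order 2p; that is, for every element σ of the quotient of SL₂(F_r) by its center, the order of σ is not equal to 2p. -/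
open Matrix in
/-- An element of `SL₂(K)` whose underlying matrix is scalar is central. -/
theorem SL2_mem_center_of_coe_eq_scalar {K : Type*} [Field K]
    {A : Matrix.SpecialLinearGroup (Fin 2) K} {c : K}
    (h : (A : Matrix (Fin 2) (Fin 2) K) = scalar _ c) :
    A ∈ Subgroup.center (Matrix.SpecialLinearGroup (Fin 2) K) := by
  refine Matrix.SpecialLinearGroup.mem_center_iff.2 ⟨c, ?_, h.symm⟩
  have hdet := A.det_coe
  rw [h] at hdet
  simpa using hdet

open Matrix in
/-- The square of an element of `SL₂(K)` is central exactly when the element is central or has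
trace zero. -/
theorem SL2_sq_mem_center_iff {K : Type*} [Field K] (A : Matrix.SpecialLinearGroup (Fin 2) K) :
    A ^ 2 ∈ Subgroup.center (Matrix.SpecialLinearGroup (Fin 2) K) ↔
      A ∈ Subgroup.center (Matrix.SpecialLinearGroup (Fin 2) K) ∨
        trace (A : Matrix (Fin 2) (Fin 2) K) = 0 := by
  have hdet := A.det_coe
  rw [det_fin_two] at hdet
  constructor
  · intro h
    obtain ⟨c, -, hc⟩ := Matrix.SpecialLinearGroup.mem_center_iff.1 h
    have h00 := congrFun (congrFun hc 0) 0
    have h01 := congrFun (congrFun hc 0) 1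
    have h10 := congrFun (congrFun hc 1) 0
    have h11 := congrFun (congrFun hc 1) 1
    simp [pow_two, mul_apply, Fin.sum_univ_two] at h00 h01 h10 h11
    rw [or_iff_not_imp_right, trace_fin_two]
    intro ht
    have e01 : A 0 1 = 0 :=
      (mul_eq_zero.1 (show (A 0 0 + A 1 1) * A 0 1 = 0 by grind)).resolve_left ht
    have e10 : A 1 0 = 0 :=
      (mul_eq_zero.1 (show (A 0 0 + A 1 1) * A 1 0 = 0 by grind)).resolve_left ht
    have e : A 0 0 - A 1 1 = 0 :=
      (mul_eq_zero.1 (show (A 0 0 + A 1 1) * (A 0 0 - A 1 1) = 0 by grind)).resolve_left ht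
    apply SL2_mem_center_of_coe_eq_scalar (c := A 0 0)
    ext i j
    fin_cases i <;> fin_cases j <;> simp [e01, e10, sub_eq_zero.1 e]
  · rintro (h | h)
    · exact pow_mem h 2
    · rw [trace_fin_two] at h
      apply SL2_mem_center_of_coe_eq_scalar (c := -1)
      ext i j
      fin_cases i <;> fin_cases j <;> simp [pow_two, mul_apply, Fin.sum_univ_two] <;> grind

/-- `PSL₂(F_r)` contains no element of order `2p`, where `r` is a power of the odd
prime `p`. -/
theorem stmt_6 (p r : ℕ) (hp : p.Prime) (hodd : Odd p)
    (m : ℕ) (hm : 0 < m) (hr : r = p ^ m)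
    (K : Type*) [Field K] [Fintype K] (hK : Fintype.card K = r)
    (σ : Matrix.SpecialLinearGroup (Fin 2) K ⧸
        Subgroup.center (Matrix.SpecialLinearGroup (Fin 2) K)) :
    orderOf σ ≠ 2 * p := by
  intro hσ
  have hr_odd : Odd r := hr ▸ hodd.pow
  have hpr : p ∣ r := hr ▸ dvd_pow_self p hm.ne'
  obtain ⟨A, rfl⟩ := QuotientGroup.mk_surjective σ
  have key (n : ℕ) : A ^ n ∈ Subgroup.center (Matrix.SpecialLinearGroup (Fin 2) K) ↔
      2 * p ∣ n := by
    rw [← QuotientGroup.eq_one_iff, QuotientGroup.mk_pow, ← hσ, orderOf_dvd_iff_pow_eq_one]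
  have hsq : (A ^ r) ^ 2 ∈ Subgroup.center (Matrix.SpecialLinearGroup (Fin 2) K) := by
    rw [← pow_mul, key, mul_comm]
    exact mul_dvd_mul hpr dvd_rfl
  rcases (SL2_sq_mem_center_iff _).1 hsq with h | h
  · exact hr_odd.not_two_dvd_nat ((dvd_mul_right 2 p).trans ((key r).1 h))
  · rw [Matrix.SpecialLinearGroup.coe_pow, ← hK, FiniteField.trace_pow_card] at h
    have hA := (key 2).1 ((SL2_sq_mem_center_iff A).2 (.inr (eq_zero_of_pow_eq_zero h)))
    have := Nat.le_of_dvd two_pos hA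
    have := hp.two_le
    omega
end

section
/- Let i be an element of F_9 with i^2 = −1, and let φ denote the automorphism of PSL₂(F_9) induced by applying the Frobenius x ↦ x^3 of F_9 to matrix entries. Suppose σ ∈ PSL₂(F_9) is such that the element φ(σ)·σ has order exactly 3. Then there exist τ ∈ PSL₂(F_9) and an element ρ of PSL₂(F_9) that is the class of the matrix [[1, 1+i],[0, 1]] or the class of the matrix [[−1+i, 1+i],[0, 1+i]], such that σ = φ(τ)·ρ·τ^{−1}. -/
/-- `σ` and `ρ` are Frobenius-twisted conjugate in `SL₂(F)`, up to sign. -/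
def FrobConj {F : Type*} [Field F] [ExpChar F 3] (σ ρ : Matrix.SpecialLinearGroup (Fin 2) F) :
    Prop :=
  ∃ τ : Matrix.SpecialLinearGroup (Fin 2) F,
    σ = Matrix.SpecialLinearGroup.map (frobenius F 3) τ * ρ * τ⁻¹ ∨
      σ = -(Matrix.SpecialLinearGroup.map (frobenius F 3) τ * ρ * τ⁻¹)

/-- The upper triangular matrix with diagonal `a, a⁻¹` and upper right entry `b`. -/
def upperSL {F : Type*} [Field F] (a : F) (ha : a ≠ 0) (b : F) :
    Matrix.SpecialLinearGroup (Fin 2) F :=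
  ⟨!![a, b; 0, a⁻¹], by simp [Matrix.det_fin_two, ha]⟩

@[simp]
theorem coe_upperSL {F : Type*} [Field F] (a : F) (ha : a ≠ 0) (b : F) :
    (upperSL a ha b : Matrix (Fin 2) (Fin 2) F) = !![a, b; 0, a⁻¹] :=
  rfl

section

open Matrix

variable {F : Type*} [Field F]

/-- A matrix in `SL₂` whose first column is a given nonzero vector exists. -/
theorem exists_specialLinearGroup_first_column {x y : F} (h : x ≠ 0 ∨ y ≠ 0) :
    ∃ τ : Matrix.SpecialLinearGroup (Fin 2) F, τ 0 0 = x ∧ τ 1 0 = y := by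
  rcases h with h | h
  · exact ⟨⟨!![x, 0; y, x⁻¹], by simp [det_fin_two, h]⟩, by simp⟩
  · exact ⟨⟨!![x, -y⁻¹; y, 0], by simp [det_fin_two, h]⟩, by simp⟩

theorem mem_center_of_diagonal {N : Matrix.SpecialLinearGroup (Fin 2) F} {r : F}
    (h : (N : Matrix (Fin 2) (Fin 2) F) = !![r, 0; 0, r]) :
    N ∈ Subgroup.center (Matrix.SpecialLinearGroup (Fin 2) F) := by
  rw [Matrix.SpecialLinearGroup.mem_center_iff]
  refine ⟨r, ?_, ?_⟩
  · have := N.2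
    rw [h] at this
    simpa [det_fin_two, sq] using this
  · rw [h]
    ext j k
    fin_cases j <;> fin_cases k <;> simp

theorem exists_sq_of_pow_four_eq_one [CharP F 3] {a i : F} (hi : i ^ 2 = -1) (ha : a ^ 4 = 1) :
    ∃ s, s ≠ 0 ∧ a = s ^ 2 := by
  have three : (3 : F) = 0 := by exact_mod_cast CharP.cast_eq_zero F 3
  have hs : ∃ s, a = s ^ 2 := by
    have : (a - 1) * ((a + 1) * ((a - i) * (a + i))) = 0 := by
      linear_combination ha - (a ^ 2 - 1) * hi
    rcases mul_eq_zero.1 this with h | h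
    · exact ⟨1, by linear_combination h⟩
    rcases mul_eq_zero.1 h with h | h
    · exact ⟨i, by linear_combination h - hi⟩
    rcases mul_eq_zero.1 h with h | h
    · exact ⟨-1 + i, by linear_combination h - hi + i * three⟩
    · exact ⟨1 + i, by linear_combination h - hi - i * three⟩
  obtain ⟨s, rfl⟩ := hs
  refine ⟨s, ?_, rfl⟩
  rintro rfl
  simp at ha

variable [ExpChar F 3]

theorem FrobConj.trans {σ ρ π : Matrix.SpecialLinearGroup (Fin 2) F} (h₁ : FrobConj σ ρ)
    (h₂ : FrobConj ρ π) : FrobConj σ π := by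
  obtain ⟨τ, h₁⟩ := h₁
  obtain ⟨υ, h₂⟩ := h₂
  refine ⟨τ * υ, ?_⟩
  rcases h₁ with rfl | rfl <;> rcases h₂ with rfl | rfl <;> simp [mul_assoc]

theorem frobConj_neg (σ : Matrix.SpecialLinearGroup (Fin 2) F) : FrobConj σ (-σ) :=
  ⟨1, by simp⟩

theorem frobConj_of_mul_eq {σ ρ τ : Matrix.SpecialLinearGroup (Fin 2) F}
    (h : σ * τ = Matrix.SpecialLinearGroup.map (frobenius F 3) τ * ρ) : FrobConj σ ρ :=
  ⟨τ, Or.inl (by rw [← h, mul_inv_cancel_right])⟩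

theorem map_frobenius_upperSL {a b : F} (ha : a ≠ 0) :
    Matrix.SpecialLinearGroup.map (frobenius F 3) (upperSL a ha b) =
      upperSL (a ^ 3) (pow_ne_zero 3 ha) (b ^ 3) := by
  ext j k
  rw [Matrix.SpecialLinearGroup.map_apply_coe]
  fin_cases j <;> fin_cases k <;> simp [frobenius_def]

theorem frobConj_upperSL_translate {a b : F} (ha : a ≠ 0) (t : F) :
    FrobConj (upperSL a ha (b - a * t + t ^ 3 * a⁻¹)) (upperSL a ha b) := by
  refine frobConj_of_mul_eq (τ := upperSL 1 one_ne_zero t) ?_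
  ext j k
  fin_cases j <;> fin_cases k <;>
    simp [map_frobenius_upperSL]
  ring

theorem frobConj_upperSL_scale {a b s : F} (ha : a ≠ 0) (hs : s ≠ 0) :
    FrobConj (upperSL (s ^ 2 * a) (mul_ne_zero (pow_ne_zero 2 hs) ha) (s ^ 4 * b))
      (upperSL a ha b) := by
  refine frobConj_of_mul_eq (τ := upperSL s hs 0) ?_
  ext j k
  fin_cases j <;> fin_cases k <;>
    simp [map_frobenius_upperSL] <;> field_simp

theorem frobConj_upperSL_neg {a b i : F} (ha : a ≠ 0) (hi : i ^ 2 = -1) :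
    FrobConj (upperSL a ha (-b)) (upperSL a ha b) := by
  have hi0 : i ≠ 0 := by rintro rfl; simp at hi
  refine (frobConj_neg _).trans ?_
  convert frobConj_upperSL_scale (b := b) ha hi0 using 1
  have h4 : i ^ 4 = 1 := by linear_combination (i ^ 2 - 1) * hi
  ext j k
  fin_cases j <;> fin_cases k <;> simp [hi, h4]

theorem frobenius_mul_self_upperSL {a b : F} (ha : a ≠ 0) :
    ((Matrix.SpecialLinearGroup.map (frobenius F 3) (upperSL a ha b) * upperSL a ha b :
      Matrix.SpecialLinearGroup (Fin 2) F) : Matrix (Fin 2) (Fin 2) F) =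
      !![a ^ 4, a ^ 3 * b + b ^ 3 * a⁻¹; 0, (a ^ 4)⁻¹] := by
  ext j k
  fin_cases j <;> fin_cases k <;> simp [map_frobenius_upperSL] <;> ring

theorem map_frobenius_map_frobenius (h9 : ∀ x : F, x ^ 9 = x)
    (σ : Matrix.SpecialLinearGroup (Fin 2) F) :
    Matrix.SpecialLinearGroup.map (frobenius F 3)
      (Matrix.SpecialLinearGroup.map (frobenius F 3) σ) = σ := by
  ext j k
  simp [frobenius_def, ← pow_mul, h9]

variable [CharP F 3]

theorem exists_frobConj_upperSL (h9 : ∀ x : F, x ^ 9 = x)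
    {σ : Matrix.SpecialLinearGroup (Fin 2) F}
    (h3 : (Matrix.SpecialLinearGroup.map (frobenius F 3) σ * σ) ^ 3 ∈
      Subgroup.center (Matrix.SpecialLinearGroup (Fin 2) F))
    (h1 : Matrix.SpecialLinearGroup.map (frobenius F 3) σ * σ ∉
      Subgroup.center (Matrix.SpecialLinearGroup (Fin 2) F)) :
    ∃ (a : F) (ha : a ≠ 0) (b : F), FrobConj σ (upperSL a ha b) ∧
      a ^ 3 * b + b ^ 3 * a⁻¹ ≠ 0 := by
  set N := Matrix.SpecialLinearGroup.map (frobenius F 3) σ * σ with hN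
  obtain ⟨x, y, r, hxy, hr3, hx, hy⟩ : ∃ x y r : F, (x ≠ 0 ∨ y ≠ 0) ∧ r ^ 3 = r ∧
      N 0 0 * x + N 0 1 * y = r * x ∧ N 1 0 * x + N 1 1 * y = r * y := by
    rw [Matrix.SpecialLinearGroup.mem_center_iff] at h3
    obtain ⟨r, hr, h3⟩ := h3
    have hr2 : r ^ 2 = 1 := by simpa using hr
    have hr3 : r ^ 3 = r := by linear_combination r * hr2
    have hdet : ((N : Matrix (Fin 2) (Fin 2) F) - scalar (Fin 2) r).det = 0 := by
      have hcomm : Commute (N : Matrix (Fin 2) (Fin 2) F) (scalar (Fin 2) r) :=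
        (scalar_commute r (fun _ => Commute.all _ _) _).symm
      have : ((N : Matrix (Fin 2) (Fin 2) F) - scalar (Fin 2) r) ^ 3 = 0 := by
        have : CharP (Matrix (Fin 2) (Fin 2) F) 3 := inferInstance
        rw [sub_pow_char_of_commute (p := 3) hcomm, ← map_pow, hr3, h3]
        simp
      have := congrArg det this
      rw [det_pow] at this
      exact (pow_eq_zero_iff three_ne_zero).1 (this.trans det_zero)
    obtain ⟨v, hv, hNv⟩ := exists_mulVec_eq_zero_iff.2 hdet
    refine ⟨v 0, v 1, r, ?_, hr3, ?_, ?_⟩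
    · by_contra! hc
      exact hv (by ext j; fin_cases j <;> simp [hc])
    · have := congrFun hNv 0
      simp [mulVec, dotProduct, Fin.sum_univ_two] at this
      linear_combination this
    · have := congrFun hNv 1
      simp [mulVec, dotProduct, Fin.sum_univ_two] at this
      linear_combination this
  obtain ⟨τ, rfl, rfl⟩ := exists_specialLinearGroup_first_column hxy
  set ρ := (Matrix.SpecialLinearGroup.map (frobenius F 3) τ)⁻¹ * σ * τ with hρ
  have hσ : FrobConj σ ρ := frobConj_of_mul_eq (τ := τ) (by rw [hρ]; group)
  have hconj : Matrix.SpecialLinearGroup.map (frobenius F 3) ρ * ρ = τ⁻¹ * N * τ := by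
    have hφ : Matrix.SpecialLinearGroup.map (frobenius F 3)
        (Matrix.SpecialLinearGroup.map (frobenius F 3) τ)
        = τ := map_frobenius_map_frobenius h9 τ
    simp only [hρ, map_mul, map_inv, hφ, hN]
    group
  have hlow : ρ 1 0 = 0 := by
    have hentry : Matrix.SpecialLinearGroup.map (frobenius F 3) τ 0 0 *
        (σ 1 0 * τ 0 0 + σ 1 1 * τ 1 0) -
        Matrix.SpecialLinearGroup.map (frobenius F 3) τ 1 0 *
        (σ 0 0 * τ 0 0 + σ 0 1 * τ 1 0) = ρ 1 0 := by
      rw [hρ]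
      simp only [Matrix.SpecialLinearGroup.coe_mul, Matrix.SpecialLinearGroup.coe_inv,
        adjugate_fin_two, mul_apply, Fin.sum_univ_two]
      simp
      ring
    rw [← hentry]
    simp only [Matrix.SpecialLinearGroup.map_apply_coe, RingHom.mapMatrix_apply, map_apply,
      frobenius_def]
    have hNσ (j k : Fin 2) : N j 0 ^ 3 * σ 0 k + N j 1 ^ 3 * σ 1 k =
        σ j 0 * N 0 k + σ j 1 * N 1 k := by
      have : Matrix.SpecialLinearGroup.map (frobenius F 3) N * σ = σ * N := by
        rw [hN, map_mul, map_frobenius_map_frobenius h9, mul_assoc]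
      have := congrArg (fun M : Matrix.SpecialLinearGroup (Fin 2) F => M j k) this
      simpa [Matrix.SpecialLinearGroup.coe_mul, mul_apply, Fin.sum_univ_two, frobenius_def]
        using this
    have hNv (j : Fin 2) : N j 0 ^ 3 * τ 0 0 ^ 3 + N j 1 ^ 3 * τ 1 0 ^ 3 = r * τ j 0 ^ 3 := by
      have : N j 0 * τ 0 0 + N j 1 * τ 1 0 = r * τ j 0 := by
        fin_cases j
        exacts [hx, hy]
      rw [← mul_pow, ← mul_pow, ← add_pow_char, this, mul_pow, hr3]
    have hNσv (j : Fin 2) : N j 0 ^ 3 * (σ 0 0 * τ 0 0 + σ 0 1 * τ 1 0) +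
        N j 1 ^ 3 * (σ 1 0 * τ 0 0 + σ 1 1 * τ 1 0) = r * (σ j 0 * τ 0 0 + σ j 1 * τ 1 0) := by
      linear_combination τ 0 0 * hNσ j 0 + τ 1 0 * hNσ j 1 + σ j 0 * hx + σ j 1 * hy
    by_contra hD
    have hcube {z : F} (hz : z ^ 3 * _ = 0) : z = 0 :=
      (pow_eq_zero_iff three_ne_zero).1 ((mul_eq_zero.1 hz).resolve_right hD)
    have e01 : N 0 1 = 0 := by
      refine hcube ?_
      linear_combination τ 0 0 ^ 3 * hNσv 0 - (σ 0 0 * τ 0 0 + σ 0 1 * τ 1 0) * hNv 0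
    have e10 : N 1 0 = 0 := by
      refine hcube ?_
      linear_combination (σ 1 0 * τ 0 0 + σ 1 1 * τ 1 0) * hNv 1 - τ 1 0 ^ 3 * hNσv 1
    have e00 : N 0 0 = r := by
      refine sub_eq_zero.1 (hcube ?_)
      rw [sub_pow_char, hr3]
      linear_combination (σ 1 0 * τ 0 0 + σ 1 1 * τ 1 0) * hNv 0 - τ 1 0 ^ 3 * hNσv 0
    have e11 : N 1 1 = r := by
      refine sub_eq_zero.1 (hcube ?_)
      rw [sub_pow_char, hr3]
      linear_combination τ 0 0 ^ 3 * hNσv 1 - (σ 0 0 * τ 0 0 + σ 0 1 * τ 1 0) * hNv 1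
    refine h1 (mem_center_of_diagonal (r := r) ?_)
    ext j k
    fin_cases j <;> fin_cases k <;> simp [e00, e01, e10, e11]
  have hdetρ : ρ 0 0 * ρ 1 1 = 1 := by
    have := ρ.2
    rw [det_fin_two, hlow] at this
    simpa using this
  have ha : ρ 0 0 ≠ 0 := left_ne_zero_of_mul_eq_one hdetρ
  have hρu : ρ = upperSL (ρ 0 0) ha (ρ 0 1) := by
    ext j k
    fin_cases j <;> fin_cases k <;> simp [hlow]
    exact eq_inv_of_mul_eq_one_right hdetρ
  refine ⟨ρ 0 0, ha, ρ 0 1, hρu ▸ hσ, fun hb => h1 ?_⟩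
  have hmat := frobenius_mul_self_upperSL (b := ρ 0 1) ha
  rw [← hρu, hb] at hmat
  have h4 : ((ρ 0 0) ^ 4)⁻¹ = (ρ 0 0) ^ 4 := by
    refine inv_eq_of_mul_eq_one_left (mul_left_cancel₀ ha ?_)
    linear_combination h9 (ρ 0 0)
  rw [h4] at hmat
  have hc := mem_center_of_diagonal hmat
  rw [hconj] at hc
  have := (inferInstance :
    (Subgroup.center (Matrix.SpecialLinearGroup (Fin 2) F)).Normal).conj_mem _ hc τ
  simpa [mul_assoc] using this

theorem frobConj_upperSL_one {i b : F} (h9 : ∀ x : F, x ^ 9 = x) (hi : i ^ 2 = -1)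
    (hb : b + b ^ 3 ≠ 0) :
    FrobConj (upperSL 1 one_ne_zero b) (upperSL 1 one_ne_zero (1 + i)) := by
  have three : (3 : F) = 0 := by exact_mod_cast CharP.cast_eq_zero F 3
  have key : ∀ c : F, c + c ^ 3 = -1 →
      FrobConj (upperSL 1 one_ne_zero c) (upperSL 1 one_ne_zero (1 + i)) := by
    intro c hc
    convert frobConj_upperSL_translate (b := 1 + i) one_ne_zero (c - (1 + i)) using 2
    have : (c - (1 + i)) ^ 3 = c ^ 3 - (1 + i ^ 3) := by
      rw [sub_pow_char, add_pow_char, one_pow]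
    rw [this]
    simp
    linear_combination -hc + i * hi + (c - i) * three
  have h : (b + b ^ 3 + 1) * (b + b ^ 3 - 1) = 0 := by
    refine mul_left_cancel₀ hb ?_
    have : (b + b ^ 3) ^ 3 = b ^ 3 + b ^ 9 := by rw [add_pow_char]; ring
    linear_combination this + h9 b
  rcases mul_eq_zero.1 h with h | h
  · exact key b (by linear_combination h)
  · have := (frobConj_upperSL_neg (b := -b) one_ne_zero hi).trans
      (key (-b) (by linear_combination -h))
    rwa [neg_neg] at this

theorem frobConj_upperSL_nonsquare {i b : F} (h9 : ∀ x : F, x ^ 9 = x) (hi : i ^ 2 = -1)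
    (hw : -1 + i ≠ 0) (hb : b - b ^ 3 ≠ 0) :
    FrobConj (upperSL (-1 + i) hw b) (upperSL (-1 + i) hw (1 + i)) := by
  have three : (3 : F) = 0 := by exact_mod_cast CharP.cast_eq_zero F 3
  have hinv : (-1 + i)⁻¹ = 1 + i := inv_eq_of_mul_eq_one_left (by linear_combination hi - three)
  have key : ∀ c : F, c - c ^ 3 = -i →
      FrobConj (upperSL (-1 + i) hw c) (upperSL (-1 + i) hw (1 + i)) := by
    intro c hc
    convert frobConj_upperSL_translate (b := 1 + i) hw ((c - (1 + i)) * (1 + i)) using 2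
    have : ((c - (1 + i)) * (1 + i)) ^ 3 = (c ^ 3 - (1 + i ^ 3)) * (1 + i ^ 3) := by
      rw [mul_pow, sub_pow_char, add_pow_char, one_pow]
    rw [this, hinv]
    have hi3 : i ^ 3 = -i := by linear_combination i * hi
    have hc3 : c ^ 3 = c + i := by linear_combination -hc
    rw [hi3, hc3]
    linear_combination (2 * c - 2 + i) * hi + (-c + 1 - i) * three
  have h : (b - b ^ 3 + i) * (b - b ^ 3 - i) = 0 := by
    refine mul_left_cancel₀ hb ?_
    have : (b - b ^ 3) ^ 3 = b ^ 3 - b ^ 9 := by rw [sub_pow_char]; ring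
    linear_combination this - h9 b - (b - b ^ 3) * hi
  rcases mul_eq_zero.1 h with h | h
  · exact key b (by linear_combination h)
  · have := (frobConj_upperSL_neg (b := -b) hw hi).trans
      (key (-b) (by linear_combination -h))
    rwa [neg_neg] at this

theorem frobConj_classification (h9 : ∀ x : F, x ^ 9 = x) {i a b : F} (hi : i ^ 2 = -1)
    (ha : a ≠ 0) (hw : -1 + i ≠ 0) (hb : a ^ 3 * b + b ^ 3 * a⁻¹ ≠ 0) :
    FrobConj (upperSL a ha b) (upperSL 1 one_ne_zero (1 + i)) ∨
      FrobConj (upperSL a ha b) (upperSL (-1 + i) hw (1 + i)) := by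
  have three : (3 : F) = 0 := by exact_mod_cast CharP.cast_eq_zero F 3
  have ha8 : (a ^ 4 - 1) * (a ^ 4 + 1) = 0 := by
    refine mul_left_cancel₀ ha ?_
    linear_combination h9 a
  have hinv : a⁻¹ = a ^ 7 := by
    refine inv_eq_of_mul_eq_one_left ?_
    linear_combination ha8
  rw [hinv] at hb
  have w4 : (-1 + i) ^ 4 = -1 := by
    linear_combination (i ^ 2 - 4 * i + 5) * hi - three
  rcases mul_eq_zero.1 ha8 with h | h
  · left
    obtain ⟨s, hs, rfl⟩ := exists_sq_of_pow_four_eq_one hi (sub_eq_zero.1 h)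
    have hs8 : s ^ 8 = 1 := by linear_combination h
    have := frobConj_upperSL_scale (b := s ^ 4 * b) one_ne_zero hs
    have e : s ^ 4 * (s ^ 4 * b) = b := by linear_combination b * hs8
    simp only [e, mul_one] at this
    refine this.trans (frobConj_upperSL_one h9 hi fun h0 => hb ?_)
    linear_combination s ^ 2 * h0
  · right
    have hq : (a * (-1 + i)⁻¹) ^ 4 = 1 := by
      rw [mul_pow, inv_pow, w4]
      linear_combination (-1 : F) * h
    obtain ⟨s, hs, hsa⟩ := exists_sq_of_pow_four_eq_one hi hq
    obtain rfl : a = s ^ 2 * (-1 + i) := by rw [← hsa, inv_mul_cancel_right₀ hw]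
    have hs8 : s ^ 8 = 1 := by
      rw [hsa] at hq
      linear_combination hq
    have := frobConj_upperSL_scale (b := s ^ 4 * b) hw hs
    have e : s ^ 4 * (s ^ 4 * b) = b := by linear_combination b * hs8
    simp only [e] at this
    refine this.trans (frobConj_upperSL_nonsquare h9 hi hw fun h0 => hb ?_)
    linear_combination s ^ 2 * (-1 + i) ^ 3 * h0 + s ^ 14 * b ^ 3 * (-1 + i) ^ 3 * w4

end

theorem pow_nine_galoisField (x : GaloisField 3 2) : x ^ 9 = x := by
  have := Fintype.ofFinite (GaloisField 3 2)
  have hc : Fintype.card (GaloisField 3 2) = 9 := by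
    rw [← Nat.card_eq_fintype_card, GaloisField.card 3 2 two_ne_zero]; norm_num
  simpa [hc] using FiniteField.pow_card x


/-- Classification of `σ ∈ PSL₂(F₉)` such that `φ(σ)·σ` has order exactly 3, where `φ` is
the automorphism induced by the Frobenius `x ↦ x^3` of `F₉` applied to matrix entries:
every such `σ` is of the form `φ(τ)·ρ·τ⁻¹` with `ρ` the class of `[[1,1+i],[0,1]]` or of
`[[-1+i,1+i],[0,1+i]]`, where `i² = -1`. -/
theorem stmt_7 (i : GaloisField 3 2) (hi : i ^ 2 = -1)
    (σ : Matrix.SpecialLinearGroup (Fin 2) (GaloisField 3 2))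
    (h : orderOf
        ((Matrix.SpecialLinearGroup.map (frobenius (GaloisField 3 2) 3) σ * σ :
            Matrix.SpecialLinearGroup (Fin 2) (GaloisField 3 2)) :
          Matrix.SpecialLinearGroup (Fin 2) (GaloisField 3 2) ⧸
            Subgroup.center (Matrix.SpecialLinearGroup (Fin 2) (GaloisField 3 2))) = 3) :
    ∃ τ ρ : Matrix.SpecialLinearGroup (Fin 2) (GaloisField 3 2),
      ((ρ : Matrix (Fin 2) (Fin 2) (GaloisField 3 2)) = !![1, 1 + i; 0, 1] ∨
        (ρ : Matrix (Fin 2) (Fin 2) (GaloisField 3 2)) = !![-1 + i, 1 + i; 0, 1 + i]) ∧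
      ((σ : Matrix.SpecialLinearGroup (Fin 2) (GaloisField 3 2) ⧸
          Subgroup.center (Matrix.SpecialLinearGroup (Fin 2) (GaloisField 3 2)))
        = ((Matrix.SpecialLinearGroup.map (frobenius (GaloisField 3 2) 3) τ * ρ * τ⁻¹ :
            Matrix.SpecialLinearGroup (Fin 2) (GaloisField 3 2)) :
          Matrix.SpecialLinearGroup (Fin 2) (GaloisField 3 2) ⧸
            Subgroup.center (Matrix.SpecialLinearGroup (Fin 2) (GaloisField 3 2)))) := by
  rw [orderOf_eq_prime_iff, ← QuotientGroup.mk_pow, QuotientGroup.eq_one_iff, Ne,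
    QuotientGroup.eq_one_iff] at h
  obtain ⟨a, ha, b, hσ, hb⟩ := exists_frobConj_upperSL pow_nine_galoisField h.1 h.2
  have three : (3 : GaloisField 3 2) = 0 := by exact_mod_cast CharP.cast_eq_zero _ 3
  have hinv : (1 + i) * (-1 + i) = 1 := by linear_combination hi - three
  have hw : -1 + i ≠ 0 := right_ne_zero_of_mul_eq_one hinv
  have exists_lift : ∀ ρ, FrobConj σ ρ → ∃ τ, (σ : Matrix.SpecialLinearGroup (Fin 2) (GaloisField 3 2) ⧸
      Subgroup.center (Matrix.SpecialLinearGroup (Fin 2) (GaloisField 3 2))) =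
      ((Matrix.SpecialLinearGroup.map (frobenius (GaloisField 3 2) 3) τ * ρ * τ⁻¹ :
        Matrix.SpecialLinearGroup (Fin 2) (GaloisField 3 2)) : _ ⧸ _) := by
    rintro ρ ⟨τ, h | h⟩
    · exact ⟨τ, congrArg _ h⟩
    · refine ⟨τ, ?_⟩
      rw [QuotientGroup.eq_iff_div_mem, h, neg_div, div_self']
      exact mem_center_of_diagonal (r := -1) (by ext j k; fin_cases j <;> fin_cases k <;> simp)
  rcases frobConj_classification pow_nine_galoisField hi ha hw hb with h | h
  · obtain ⟨τ, hτ⟩ := exists_lift _ (hσ.trans h)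
    exact ⟨τ, _, Or.inl (by simp [upperSL]), hτ⟩
  · obtain ⟨τ, hτ⟩ := exists_lift _ (hσ.trans h)
    exact ⟨τ, _, Or.inr (by simp [upperSL, inv_eq_of_mul_eq_one_left hinv]), hτ⟩
end

section
/- Let K be a field of characteristic 3 and let b, c be nonzero elements of K. Let v, w ∈ K satisfy w^2 = c·(v^3 − b v^2 − b^2 v + b^3 − c^2)·(v^3 + b v^2 − b^2 v − b^3 − c^2), and suppose D := v^3 − b v^2 − b^2 v + b^3 − c^2 is nonzero. Define x = −bc(v − b)/D, z = −w/D, and y = (z^3 + bxz)/c. Then y^2 = x^3 − bx + c. (This exhibits the degree-3 map φ_{b,c} from the genus-2 curve C_{b,c} to the elliptic curve E_{b,c}.) -/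
/-- The map `φ_{b,c}` from the genus-2 curve `C_{b,c}` to the elliptic curve `E_{b,c}`:
if `(v, w)` is a point of `C_{b,c}` with `D = v³ - bv² - b²v + b³ - c² ≠ 0`, then
`x = -bc(v-b)/D`, `z = -w/D`, `y = (z³ + bxz)/c` satisfy `y² = x³ - bx + c`. -/
theorem stmt_8 (K : Type*) [Field K] [CharP K 3]
    (b c : K) (hb : b ≠ 0) (hc : c ≠ 0) (v w : K)
    (hw : w ^ 2 = c * (v ^ 3 - b * v ^ 2 - b ^ 2 * v + b ^ 3 - c ^ 2)
        * (v ^ 3 + b * v ^ 2 - b ^ 2 * v - b ^ 3 - c ^ 2))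
    (hD : v ^ 3 - b * v ^ 2 - b ^ 2 * v + b ^ 3 - c ^ 2 ≠ 0)
    (x z y : K)
    (hx : x = -b * c * (v - b) / (v ^ 3 - b * v ^ 2 - b ^ 2 * v + b ^ 3 - c ^ 2))
    (hz : z = -w / (v ^ 3 - b * v ^ 2 - b ^ 2 * v + b ^ 3 - c ^ 2))
    (hy : y = (z ^ 3 + b * x * z) / c) :
    y ^ 2 = x ^ 3 - b * x + c := by
  have h3 : (3 : K) = 0 := by exact_mod_cast CharP.cast_eq_zero K 3
  obtain ⟨u, hu⟩ : ∃ u, u = v - b := ⟨_, rfl⟩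
  have hv : v = u + b := by rw [hu]; ring
  generalize hDv : v ^ 3 - b * v ^ 2 - b ^ 2 * v + b ^ 3 - c ^ 2 = D at *
  have hDu : D = u ^ 3 - b * u ^ 2 - c ^ 2 := by
    rw [← hDv, hv]
    linear_combination (b * u ^ 2) * h3
  have hB : v ^ 3 + b * v ^ 2 - b ^ 2 * v - b ^ 3 - c ^ 2 = D - b * u ^ 2 + b ^ 2 * u := by
    rw [← hDv, hu]
    linear_combination (b * v ^ 2 - b ^ 2 * v) * h3
  rw [hB] at hw
  rw [← hu] at hx
  have hz2 : z ^ 2 = c * (D - b * u ^ 2 + b ^ 2 * u) / D := by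
    rw [hz, div_pow, neg_sq, hw]
    field_simp
  have key : (D - b * u ^ 2 + b ^ 2 * u) * (D - b * u ^ 2) ^ 2
      = D ^ 3 + b ^ 2 * u * D ^ 2 - b ^ 3 * c ^ 2 * u ^ 3 := by
    linear_combination (-(D - b * u ^ 2 + b ^ 2 * u) * b * u ^ 2 * D) * h3
      + b ^ 3 * u ^ 3 * hDu
  have hy2 : y ^ 2 = z ^ 2 * (z ^ 2 + b * x) ^ 2 / c ^ 2 := by
    rw [hy, div_pow]
    ring
  have hzx : z ^ 2 + b * x = c * (D - b * u ^ 2) / D := by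
    rw [hz2, hx]
    ring
  have hyD : y ^ 2 = c * ((D - b * u ^ 2 + b ^ 2 * u) * (D - b * u ^ 2) ^ 2) / D ^ 3 := by
    rw [hy2, hzx, hz2]
    field_simp
  rw [hyD, key, hx]
  field_simp
  ring
end

section
/- Let K be a field of characteristic 3 and let b, c be nonzero elements of K. Let x, y, z ∈ K satisfy y^2 = x^3 − bx + c and z^3 + bxz = cy, and suppose x ≠ 0. Define v = −b + (z^2 − c)/x and w = −z·(v^3 − b v^2 − b^2 v + b^3 − c^2). Then w^2 = c·(v^3 − b v^2 − b^2 v + b^3 − c^2)·(v^3 + b v^2 − b^2 v − b^3 − c^2); that is, (v, w) is a point of the genus-2 curve C_{b,c}. -/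
/-- If `(x, y, z)` with `x ≠ 0` satisfies `y² = x³ - bx + c` and `z³ + bxz = cy`, then
`v = -b + (z² - c)/x` and `w = -z(v³ - bv² - b²v + b³ - c²)` give a point `(v, w)` of the
genus-2 curve `C_{b,c}`. -/
theorem stmt_9 (K : Type*) [Field K] [CharP K 3]
    (b c : K) (hb : b ≠ 0) (hc : c ≠ 0) (x y z : K)
    (h1 : y ^ 2 = x ^ 3 - b * x + c)
    (h2 : z ^ 3 + b * x * z = c * y)
    (hx : x ≠ 0)
    (v w : K)
    (hv : v = -b + (z ^ 2 - c) / x)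
    (hw : w = -z * (v ^ 3 - b * v ^ 2 - b ^ 2 * v + b ^ 3 - c ^ 2)) :
    w ^ 2 = c * (v ^ 3 - b * v ^ 2 - b ^ 2 * v + b ^ 3 - c ^ 2)
        * (v ^ 3 + b * v ^ 2 - b ^ 2 * v - b ^ 3 - c ^ 2) := by
  have h3 : (3 : K) = 0 := by exact_mod_cast CharP.cast_eq_zero K 3
  have hz : z ^ 2 = c + x * (v + b) := by
    rw [hv]
    field_simp
    ring
  have hcubic : z ^ 2 * (z ^ 2 + b * x) ^ 2 = c ^ 2 * (x ^ 3 - b * x + c) := by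
    rw [← h1]
    linear_combination (z ^ 3 + b * x * z + c * y) * h2
  rw [hz] at hcubic
  have hP : x * (v ^ 3 - b * v ^ 2 - b ^ 2 * v + b ^ 3 - c ^ 2) = -(c * b * (v - b)) := by
    apply mul_left_cancel₀ (pow_ne_zero 2 hx)
    linear_combination hcubic - (x * c ^ 2 * (v + 2 * b)
      + x ^ 2 * c * ((v + 2 * b) * (v + b) + b ^ 2)
      + x ^ 3 * b * (v + b) * (2 * v + b)) * h3
  have hPQ : z ^ 2 * (v ^ 3 - b * v ^ 2 - b ^ 2 * v + b ^ 3 - c ^ 2)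
      = c * (v ^ 3 + b * v ^ 2 - b ^ 2 * v - b ^ 3 - c ^ 2) := by
    rw [hz]
    linear_combination (v + b) * hP - c * b * (v ^ 2 - b ^ 2) * h3
  rw [hw]
  linear_combination (v ^ 3 - b * v ^ 2 - b ^ 2 * v + b ^ 3 - c ^ 2) * hPQ
end

section
/- Let k be an algebraically closed field, and let A, B, A', B' be elements of k with B ≠ 0 and B' ≠ 0. If A^5·(B')^3 = (A')^5·B^3 (i.e., A^5/B^3 = (A')^5/(B')^3), then there exists a nonzero λ ∈ k such that A' = λ^6·A and B' = λ^{10}·B. (This says that the weighted-projective point [0:0:A:0:B], with weights 2,4,6,8,10, is determined by the invariant A^5/B^3.) -/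
/-- Over an algebraically closed field, the weighted-projective point `[0:0:A:0:B]`
(weights 2,4,6,8,10, with `B ≠ 0`) is determined by the invariant `A⁵/B³`: if
`A⁵ B'³ = A'⁵ B³` then there is a nonzero `λ` with `A' = λ⁶ A` and `B' = λ¹⁰ B`. -/
theorem stmt_11 (k : Type*) [Field k] [IsAlgClosed k]
    (A B A' B' : k) (hB : B ≠ 0) (hB' : B' ≠ 0)
    (h : A ^ 5 * B' ^ 3 = A' ^ 5 * B ^ 3) :
    ∃ lam : k, lam ≠ 0 ∧ A' = lam ^ 6 * A ∧ B' = lam ^ 10 * B := by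
  have hb : B' / B ≠ 0 := div_ne_zero hB' hB
  by_cases hA : A = 0
  · have hA' : A' = 0 := by simpa [hA, hB] using h.symm
    obtain ⟨lam, hlam⟩ := IsAlgClosed.exists_pow_nat_eq (B' / B) (n := 10) (by norm_num)
    refine ⟨lam, ?_, by simp [hA, hA'], by rw [hlam, div_mul_cancel₀ _ hB]⟩
    rintro rfl
    exact hb (by simpa using hlam.symm)
  · have hA' : A' ≠ 0 := by
      rintro rfl
      simp [hA, hB'] at h
    have ha : A' / A ≠ 0 := div_ne_zero hA' hA
    have hab : (A' / A) ^ 5 = (B' / B) ^ 3 := by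
      rw [div_pow, div_pow, div_eq_div_iff (pow_ne_zero _ hA) (pow_ne_zero _ hB), ← h, mul_comm]
    obtain ⟨lam, hlam⟩ :=
      IsAlgClosed.exists_pow_nat_eq ((A' / A) ^ 2 / (B' / B)) (n := 2) (by norm_num)
    have h6 : lam ^ 6 = A' / A := by
      rw [show lam ^ 6 = (lam ^ 2) ^ 3 by ring, hlam, div_pow,
        div_eq_iff (pow_ne_zero _ hb), ← hab]
      ring
    have h10 : lam ^ 10 = B' / B := by
      rw [show lam ^ 10 = (lam ^ 2) ^ 5 by ring, hlam, div_pow,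
        div_eq_iff (pow_ne_zero _ hb), ← pow_mul, mul_comm 2 5, pow_mul, hab]
      ring
    refine ⟨lam, ?_, by rw [h6, div_mul_cancel₀ _ hA], by rw [h10, div_mul_cancel₀ _ hB]⟩
    rintro rfl
    exact ha (by simpa using h6.symm)
end

section
/- Let k be a field of characteristic 3, let A, B ∈ k with B ≠ 0, and suppose that in k[x] we have (x^3 + a_2 x^2 + a_1 x + a_0)·(x^3 + b_2 x^2 + b_1 x + b_0) = x^6 + A x^3 + B x + A^2. Then b_2 = −a_2, the element u := a_2 is nonzero, and a_1 + b_1 = u^2. Moreover, writing v = a_1/u^2 (so that a_1 = u^2 v and b_1 = u^2(1 − v)), w = a_0, and t = b_0, one has t = w + u^3(v^2 − v) and w·(v + 1) = −u^3·(v^4 − v^2 + 1); in particular v ≠ −1. -/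
open Polynomial in
/-- Comparison of coefficients in a factorization of `x⁶ + Ax³ + Bx + D` into two monic cubics. -/
theorem coeffs_of_mul_monic_cubics {R : Type*} [CommRing R] {A B D a2 a1 a0 b2 b1 b0 : R}
    (h : (X ^ 3 + C a2 * X ^ 2 + C a1 * X + C a0)
          * (X ^ 3 + C b2 * X ^ 2 + C b1 * X + C b0)
        = X ^ 6 + C A * X ^ 3 + C B * X + C D) :
    a0 * b0 = D ∧ a1 * b0 + a0 * b1 = B ∧ a2 * b0 + a1 * b1 + a0 * b2 = 0 ∧
      a0 + b0 + a2 * b1 + a1 * b2 = A ∧ a1 + b1 + a2 * b2 = 0 ∧ a2 + b2 = 0 := by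
  have expand : X ^ 6 + C (a2 + b2) * X ^ 5 + C (a1 + b1 + a2 * b2) * X ^ 4
      + C (a0 + b0 + a2 * b1 + a1 * b2) * X ^ 3 + C (a2 * b0 + a1 * b1 + a0 * b2) * X ^ 2
      + C (a1 * b0 + a0 * b1) * X + C (a0 * b0)
      = X ^ 6 + C A * X ^ 3 + C B * X + C D := by
    rw [← h]
    simp only [C_add, C_mul]
    ring
  have coeff_eq (n : ℕ) := congrArg (fun p => coeff p n) expand
  simp only [coeff_add, coeff_C_mul, coeff_X_pow, coeff_X, coeff_C] at coeff_eq
  refine ⟨?_, ?_, ?_, ?_, ?_, ?_⟩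
  · simpa using coeff_eq 0
  · simpa using coeff_eq 1
  · simpa using coeff_eq 2
  · simpa using coeff_eq 3
  · simpa using coeff_eq 4
  · simpa using coeff_eq 5


open Polynomial in
/-- Factorizations of `x⁶ + Ax³ + Bx + A²` (with `B ≠ 0`) into two monic cubics over a
field of characteristic 3: writing the factors as `x³ + a₂x² + a₁x + a₀` and
`x³ + b₂x² + b₁x + b₀`, one has `b₂ = -a₂`, `u := a₂ ≠ 0`, `a₁ + b₁ = u²`, and with
`v = a₁/u²`, `w = a₀`, `t = b₀`: `t = w + u³(v² - v)`, `w(v+1) = -u³(v⁴ - v² + 1)`, and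
in particular `v ≠ -1`. -/
theorem stmt_12 (k : Type*) [Field k] [CharP k 3]
    (A B : k) (hB : B ≠ 0) (a2 a1 a0 b2 b1 b0 : k)
    (h : (X ^ 3 + C a2 * X ^ 2 + C a1 * X + C a0)
          * (X ^ 3 + C b2 * X ^ 2 + C b1 * X + C b0)
        = X ^ 6 + C A * X ^ 3 + C B * X + C (A ^ 2)) :
    b2 = -a2 ∧ a2 ≠ 0 ∧ a1 + b1 = a2 ^ 2 ∧
      b0 = a0 + a2 ^ 3 * ((a1 / a2 ^ 2) ^ 2 - a1 / a2 ^ 2) ∧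
      a0 * (a1 / a2 ^ 2 + 1) = -a2 ^ 3 * ((a1 / a2 ^ 2) ^ 4 - (a1 / a2 ^ 2) ^ 2 + 1) ∧
      a1 / a2 ^ 2 ≠ -1 := by
  obtain ⟨h0, h1, h2, h3, h4, h5⟩ := coeffs_of_mul_monic_cubics h
  have three : (3 : k) = 0 := CharP.cast_eq_zero k 3
  obtain rfl : b2 = -a2 := by linear_combination h5
  have hsum : a1 + b1 = a2 ^ 2 := by linear_combination h4
  have hu : a2 ≠ 0 := by
    rintro rfl
    obtain rfl : b1 = -a1 := by linear_combination hsum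
    obtain rfl : a1 = 0 := by
      rw [← sq_eq_zero_iff]
      linear_combination -h2
    exact hB (by linear_combination -h1)
  obtain ⟨v, rfl⟩ : ∃ v, a1 = a2 ^ 2 * v := ⟨a1 / a2 ^ 2, by field_simp⟩
  obtain rfl : b1 = a2 ^ 2 * (1 - v) := by linear_combination hsum
  rw [mul_div_cancel_left₀ v (pow_ne_zero 2 hu)]
  obtain rfl : b0 = a0 + a2 ^ 3 * (v ^ 2 - v) := by
    apply mul_left_cancel₀ hu
    linear_combination h2
  have hA : A = -a0 + a2 ^ 3 * (v ^ 2 + 1) := by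
    linear_combination -h3 + (a0 - a2 ^ 3 * v) * three
  have hw : a0 * (v + 1) = -a2 ^ 3 * (v ^ 4 - v ^ 2 + 1) := by
    apply mul_left_cancel₀ (pow_ne_zero 3 hu)
    rw [hA] at h0
    linear_combination -h0 + (a0 * a2 ^ 3 * v ^ 2 + a0 * a2 ^ 3 - a2 ^ 6 * v ^ 2) * three
  refine ⟨rfl, hu, hsum, rfl, hw, ?_⟩
  rintro rfl
  exact pow_ne_zero 3 hu (by linear_combination hw)
end

section
/- Let q = 3^d with d odd, let K be a finite field with q elements, and let b, c ∈ K with b a nonzero square. Let t = Tr_{K/F_3}(c · b^{3(q−3)/4}) ∈ F_3, and let T be the integer 0, 1, or −1 according as t = 0, t = 1, or t = −1. Then the number of pairs (x, y) ∈ K × K with y^2 = x^3 − bx + c equals q − T·(−3)^{(d+1)/2}. (Equivalently, the elliptic curve y^2 = x^3 − bx + c over F_q has trace of Frobenius T·(−3)^{(d+1)/2}.) -/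
theorem exists_algebraMap_eq_of_pow_eq_self {p : ℕ} [Fact p.Prime] {K : Type*} [Field K]
    [Algebra (ZMod p) K] {x : K} (hx : x ^ p = x) : ∃ r, algebraMap (ZMod p) K r = x := by
  have : CharP K p := charP_of_injective_algebraMap' (ZMod p) p
  obtain ⟨r, hr⟩ := (mem_bot_iff_intCast p K).1 ((Subfield.mem_bot_iff_pow_eq_self K p).2 hx)
  exact ⟨r, by rw [map_intCast, hr]⟩

theorem AddChar.map_sum_eq_prod {A M ι : Type*} [AddCommMonoid A] [CommMonoid M]
    (ψ : AddChar A M) (s : Finset ι) (f : ι → A) : ψ (∑ i ∈ s, f i) = ∏ i ∈ s, ψ (f i) :=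
  map_prod ψ.toMonoidHom (fun i => Multiplicative.ofAdd (f i)) s

theorem discr_isSquare_of_odd_finrank {p : ℕ} [Fact p.Prime] {K : Type*} [Field K] [Finite K]
    [Algebra (ZMod p) K] {n : ℕ} (hn : Odd n) (hfr : Module.finrank (ZMod p) K = n)
    (v : Fin n → K) : IsSquare (Algebra.discr (ZMod p) v) := by
  have : CharP K p := charP_of_injective_algebraMap' (ZMod p) p
  let M : Matrix (Fin n) (Fin n) K := Matrix.of fun i j => v j ^ p ^ (i : ℕ)
  have hM : algebraMap (ZMod p) K (Algebra.discr (ZMod p) v) = M.det ^ 2 := by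
    have h : (Algebra.traceMatrix (ZMod p) v).map (algebraMap (ZMod p) K) = M.transpose * M := by
      ext i j
      simp [Matrix.mul_apply, M, Algebra.traceMatrix_apply, Algebra.traceForm_apply,
        FiniteField.algebraMap_trace_eq_sum_pow, hfr, Finset.sum_range, mul_pow]
    rw [Algebra.discr_def, RingHom.map_det, RingHom.mapMatrix_apply, h, Matrix.det_mul,
      Matrix.det_transpose, sq]
  have hfrob : M.det ^ p = M.det := by
    obtain ⟨m, rfl⟩ : ∃ m, n = m + 1 := ⟨n - 1, by have := hn.pos; omega⟩
    have hcard : Nat.card K = p ^ (m + 1) := by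
      rw [Module.natCard_eq_pow_finrank (K := ZMod p), hfr, Nat.card_zmod]
    have h : M.map (frobenius K p) = M.submatrix (finRotate (m + 1)) id := by
      ext i j
      simp only [Matrix.map_apply, Matrix.submatrix_apply, M, Matrix.of_apply, id, frobenius_def,
        ← pow_mul, ← pow_succ, coe_finRotate]
      split_ifs with hi
      · have := Fintype.ofFinite K
        rw [hi, Fin.val_last, pow_zero, pow_one, ← hcard, Nat.card_eq_fintype_card,
          FiniteField.pow_card]
      · rfl
    have hsign : Equiv.Perm.sign (finRotate (m + 1)) = 1 := by
      rw [sign_finRotate, Nat.add_sub_cancel]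
      exact Even.neg_one_pow (by grind)
    rw [← frobenius_def, RingHom.map_det, RingHom.mapMatrix_apply, h, Matrix.det_permute, hsign]
    simp
  obtain ⟨r, hr⟩ := exists_algebraMap_eq_of_pow_eq_self hfrob
  refine ⟨r, (algebraMap (ZMod p) K).injective ?_⟩
  rw [hM, ← hr, sq, map_mul]

theorem card_pow_sub_self_eq {p : ℕ} [Fact p.Prime] {K : Type*} [Field K] [Finite K]
    [Algebra (ZMod p) K] (a : K) :
    Nat.card {x : K // x ^ p - x = a} = if Algebra.trace (ZMod p) K a = 0 then p else 0 := by
  let f : K →ₗ[ZMod p] K := (FiniteField.frobeniusAlgHom (ZMod p) K).toLinearMap - LinearMap.id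
  have hf (x : K) : f x = x ^ p - x := by simp [f]
  have hker : LinearMap.ker f = LinearMap.range (Algebra.linearMap (ZMod p) K) := by
    ext x
    rw [LinearMap.mem_ker, hf, sub_eq_zero]
    constructor
    · exact exists_algebraMap_eq_of_pow_eq_self
    · rintro ⟨r, rfl⟩
      rw [Algebra.linearMap_apply, ← map_pow, ZMod.pow_card]
  have hfinrank : Module.finrank (ZMod p) (LinearMap.ker f) = 1 := by
    rw [hker, LinearMap.finrank_range_of_inj (algebraMap (ZMod p) K).injective,
      Module.finrank_self]
  have hrange : LinearMap.range f = LinearMap.ker (Algebra.trace (ZMod p) K) := by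
    apply Submodule.eq_of_le_of_finrank_eq
    · rintro _ ⟨x, rfl⟩
      have := Algebra.trace_eq_of_algEquiv
        (FiniteField.frobeniusAlgEquivOfAlgebraic (ZMod p) K) x
      rw [LinearMap.mem_ker, hf, map_sub, ← this]
      simp
    · have h1 := LinearMap.finrank_range_add_finrank_ker f
      have h2 := LinearMap.finrank_range_add_finrank_ker (Algebra.trace (ZMod p) K)
      rw [LinearMap.range_eq_top.2 (Algebra.trace_surjective (ZMod p) K), finrank_top,
        Module.finrank_self] at h2
      omega
  split_ifs with ha
  · obtain ⟨x₀, hx₀⟩ : a ∈ LinearMap.range f := by rwa [hrange, LinearMap.mem_ker]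
    have e : {x : K // x ^ p - x = a} ≃ LinearMap.ker f :=
      (Equiv.subRight x₀).subtypeEquiv fun x => by
        simp [LinearMap.mem_ker, map_sub, hx₀, ← hf, sub_eq_zero]
    rw [Nat.card_congr e, Module.natCard_eq_pow_finrank (K := ZMod p), hfinrank, Nat.card_zmod,
      pow_one]
  · rw [Nat.card_eq_zero]
    left
    constructor
    rintro ⟨x, hx⟩
    apply ha
    rw [← LinearMap.mem_ker, ← hrange]
    exact ⟨x, by rw [hf, hx]⟩

theorem sum_addChar_quadratic_eq_prod {F V R ι : Type*} [CommRing F] [Fintype F] [AddCommGroup V]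
    [Module F V] [Fintype V] [CommRing R] [Fintype ι] (ψ : AddChar F R)
    (B : LinearMap.BilinForm F V) (v : Module.Basis ι F V) (hv : B.IsOrthoᵢ v) :
    ∑ y, ψ (B y y) = ∏ i, ∑ x, ψ (B (v i) (v i) * x ^ 2) := by
  classical
  rw [Finset.prod_univ_sum, Fintype.piFinset_univ, ← v.equivFun.symm.toEquiv.sum_comp]
  refine Finset.sum_congr rfl fun g _ => ?_
  rw [← AddChar.map_sum_eq_prod]
  congr 1
  simp only [LinearEquiv.coe_toEquiv, Module.Basis.equivFun_symm_apply, map_sum,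
    LinearMap.sum_apply, map_smul, LinearMap.smul_apply, smul_eq_mul]
  refine Finset.sum_congr rfl fun i _ => ?_
  rw [Finset.sum_eq_single i]
  · ring
  · intro j _ hj
    rw [hv hj]
    simp
  · simp

theorem discr_eq_prod_of_isOrtho {F K ι : Type*} [Field F] [Field K] [Algebra F K] [Fintype ι]
    [DecidableEq ι] {v : ι → K} (hv : (Algebra.traceForm F K).IsOrthoᵢ v) :
    Algebra.discr F v = ∏ i, Algebra.traceForm F K (v i) (v i) := by
  rw [Algebra.discr_def, ← Matrix.det_diagonal]
  congr 1
  ext i j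
  rw [Algebra.traceMatrix_apply, Matrix.diagonal_apply]
  split_ifs with hij
  · rw [hij]
  · exact hv hij

theorem sum_addChar_zmod_three_mul_sq {R : Type*} [CommRing R] (ψ : AddChar (ZMod 3) R)
    (hψ : 1 + ψ 1 + ψ (-1) = 0) {w : ZMod 3} (hw : w ≠ 0) :
    ∑ x, ψ (w * x ^ 2) = (quadraticChar (ZMod 3) w : R) * (ψ 1 - ψ (-1)) := by
  have hw : w = 1 ∨ w = -1 := by revert w; decide
  have h : ∑ x, ψ (w * x ^ 2) = 1 + 2 * ψ w := by
    rw [show (Finset.univ : Finset (ZMod 3)) = {0, 1, -1} from rfl]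
    rw [Finset.sum_insert (by decide), Finset.sum_insert (by decide), Finset.sum_singleton]
    simp
    ring
  obtain rfl | rfl := hw
  · rw [h, MulChar.map_one, Int.cast_one]
    linear_combination hψ
  · rw [h, show quadraticChar (ZMod 3) (-1) = -1 by decide]
    push_cast
    linear_combination hψ

theorem sum_addChar_trace_sq {K R : Type*} [Field K] [Fintype K] [Algebra (ZMod 3) K]
    [CommRing R] (hd : Odd (Module.finrank (ZMod 3) K)) (ψ : AddChar (ZMod 3) R)
    (hψ : 1 + ψ 1 + ψ (-1) = 0) :
    ∑ y : K, ψ (Algebra.trace (ZMod 3) K (y ^ 2)) =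
      (ψ 1 - ψ (-1)) ^ Module.finrank (ZMod 3) K := by
  have : Invertible (2 : ZMod 3) := ⟨2, rfl, rfl⟩
  obtain ⟨v, hv⟩ := LinearMap.BilinForm.exists_orthogonal_basis
    (B := Algebra.traceForm (ZMod 3) K) (LinearMap.BilinForm.isSymm_iff.1 (Algebra.traceForm_isSymm _))
  have hsq := discr_isSquare_of_odd_finrank hd rfl v
  have hne := Algebra.discr_not_zero_of_basis (ZMod 3) v
  rw [discr_eq_prod_of_isOrtho hv] at hsq hne
  have h := sum_addChar_quadratic_eq_prod ψ _ v hv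
  simp only [Algebra.traceForm_apply, ← sq] at h hsq hne
  rw [h, Finset.prod_congr rfl fun i _ =>
    sum_addChar_zmod_three_mul_sq ψ hψ (Finset.prod_ne_zero_iff.1 hne i (Finset.mem_univ i)),
    Finset.prod_mul_distrib, ← Int.cast_prod, ← map_prod,
    (quadraticChar_one_iff_isSquare hne).2 hsq]
  simp

theorem three_mul_card_trace_sq_eq {K : Type*} [Field K] [Fintype K] [Algebra (ZMod 3) K]
    {m : ℕ} (hd : Module.finrank (ZMod 3) K = 2 * m + 1) {T : ℤ} (hT : T = 0 ∨ T = 1 ∨ T = -1) :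
    (3 * Nat.card {y : K // Algebra.trace (ZMod 3) K (y ^ 2) = T} : ℤ) =
      Fintype.card K + 3 * T * (-3) ^ m := by
  classical
  obtain ⟨ζ, hζ⟩ : ∃ ζ : ℂ, IsPrimitiveRoot ζ 3 := ⟨_, Complex.isPrimitiveRoot_exp 3 (by simp)⟩
  have hζ0 : 1 + ζ + ζ ^ 2 = 0 := by
    simpa [Finset.sum_range_succ] using hζ.geom_sum_eq_zero (by norm_num)
  let ψ : AddChar (ZMod 3) ℂ := AddChar.zmodChar 3 hζ.pow_eq_one
  have h1 : ψ 1 = ζ := by simp [ψ, AddChar.zmodChar_apply, show (1 : ZMod 3).val = 1 from rfl]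
  have h2 : ψ (-1) = ζ ^ 2 := by
    simp [ψ, AddChar.zmodChar_apply, show (-1 : ZMod 3).val = 2 from rfl]
  have hψ : 1 + ψ 1 + ψ (-1) = 0 := by rw [h1, h2, hζ0]
  have hind (u : ZMod 3) : 1 + ψ u + ψ⁻¹ u = if u = 0 then 3 else 0 := by
    rw [AddChar.inv_apply]
    obtain rfl | rfl | rfl : u = 0 ∨ u = 1 ∨ u = -1 := by revert u; decide
    · simp
      norm_num
    · simpa using hψ
    · rw [neg_neg, add_right_comm, hψ]
      simp
  have hS := sum_addChar_trace_sq (K := K) ⟨m, hd⟩ ψ hψ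
  have hS' := sum_addChar_trace_sq (K := K) ⟨m, hd⟩ ψ⁻¹
    (by rw [AddChar.inv_apply, AddChar.inv_apply, neg_neg, add_right_comm, hψ])
  have hcount : (3 * Nat.card {y : K // Algebra.trace (ZMod 3) K (y ^ 2) = T} : ℂ) =
      ∑ y : K, (1 + ψ (Algebra.trace (ZMod 3) K (y ^ 2) - T) +
        ψ⁻¹ (Algebra.trace (ZMod 3) K (y ^ 2) - T)) := by
    simp_rw [hind, sub_eq_zero, Finset.sum_ite, Finset.sum_const_zero, Finset.sum_const,
      Nat.card_eq_fintype_card, Fintype.card_subtype]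
    simp [mul_comm]
  have hg : (ζ - ζ ^ 2) ^ 2 = -3 := by linear_combination (ζ ^ 2 - 3 * ζ + 3) * hζ0
  simp_rw [sub_eq_add_neg, AddChar.map_add_eq_mul, Finset.sum_add_distrib, ← Finset.sum_mul, hS,
    hS', AddChar.inv_apply, neg_neg, h1, h2, hd, pow_succ _ (2 * m), pow_mul,
    ← neg_sub ζ (ζ ^ 2), neg_sq, hg] at hcount
  have : (3 * Nat.card {y : K // Algebra.trace (ZMod 3) K (y ^ 2) = T} : ℂ) =
      Fintype.card K + 3 * T * (-3) ^ m := by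
    rw [hcount]
    obtain rfl | rfl | rfl := hT
    · simp
      ring
    · simp [h1, h2]
      linear_combination -(-3) ^ m * hg
    · simp [h1, h2]
      linear_combination (-3) ^ m * hg
  exact_mod_cast this

theorem card_artinSchreier_curve {K : Type*} [Field K] [Fintype K] [Algebra (ZMod 3) K]
    {m : ℕ} (hd : Module.finrank (ZMod 3) K = 2 * m + 1) {T : ℤ} (hT : T = 0 ∨ T = 1 ∨ T = -1)
    {e : K} (he : Algebra.trace (ZMod 3) K e = T) :
    (Nat.card {P : K × K // P.2 ^ 2 = P.1 ^ 3 - P.1 + e} : ℤ) =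
      Fintype.card K + 3 * T * (-3) ^ m := by
  classical
  rw [← three_mul_card_trace_sq_eq hd hT]
  norm_cast
  have E : {P : K × K // P.2 ^ 2 = P.1 ^ 3 - P.1 + e} ≃
      Σ y : K, {x : K // x ^ 3 - x = y ^ 2 - e} :=
    { toFun := fun P => ⟨P.1.2, P.1.1, by rw [P.2]; ring⟩
      invFun := fun P => ⟨(P.2.1, P.1), by simp [P.2.2]⟩
      left_inv := fun P => rfl
      right_inv := fun P => rfl }
  rw [Nat.card_congr E, Nat.card_sigma]
  simp_rw [card_pow_sub_self_eq, map_sub, he, sub_eq_zero]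
  rw [Finset.sum_ite, Finset.sum_const_zero, Finset.sum_const, Nat.card_eq_fintype_card,
    Fintype.card_subtype, smul_eq_mul, mul_comm, add_zero]

/-- Point counts for supersingular elliptic curves `y² = x³ - bx + c` over `F_q`,
`q = 3^d` with `d` odd, when `b` is a nonzero square: the number of affine points is
`q - T·(-3)^((d+1)/2)` where `T ∈ {0, 1, -1}` is the integer matching the trace
`Tr_{F_q/F_3}(c / s(b)³)`, with `s(b) = b^((3-q)/4)` the distinguished square root,
so that `c / s(b)³ = c · b^(3(q-3)/4)`. -/
theorem stmt_13 (d : ℕ) (hd : Odd d) (q : ℕ) (hq : q = 3 ^ d)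
    (K : Type*) [Field K] [Fintype K] (hK : Fintype.card K = q)
    (b c : K) (hb : b ≠ 0) (hbsq : ∃ s : K, b = s ^ 2)
    (T : ℤ) (hT : T = 0 ∨ T = 1 ∨ T = -1)
    (htr : ∑ i ∈ Finset.range d, (c * b ^ (3 * ((q - 3) / 4))) ^ 3 ^ i = (T : K)) :
    (Nat.card {P : K × K // P.2 ^ 2 = P.1 ^ 3 - b * P.1 + c} : ℤ)
      = (q : ℤ) - T * (-3) ^ ((d + 1) / 2) := by
  obtain ⟨m, rfl⟩ := hd
  have : CharP K 3 := charP_of_card_eq_prime_pow (hK.trans hq)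
  let : Algebra (ZMod 3) K := ZMod.algebra K 3
  have hfr : Module.finrank (ZMod 3) K = 2 * m + 1 := by
    have h := Module.card_eq_pow_finrank (K := ZMod 3) (V := K)
    rw [hK, hq, ZMod.card] at h
    exact (Nat.pow_right_injective (by norm_num) h).symm
  obtain ⟨t, rfl⟩ := hbsq
  have ht : t ≠ 0 := fun h => hb (by simp [h])
  obtain ⟨n, hn⟩ : ∃ n, q = 4 * n + 3 := by
    have h : q % 4 = 3 := by
      simp [hq, pow_succ, pow_mul, Nat.mul_mod, Nat.pow_mod]
    exact ⟨q / 4, by omega⟩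
  rw [show (q - 3) / 4 = n by omega] at htr
  have hw : t ^ n ≠ 0 := pow_ne_zero n ht
  have hone : t ^ 2 * (t ^ n) ^ 4 = 1 := by
    rw [← FiniteField.pow_card_sub_one_eq_one t ht, hK, hn]
    rw [← pow_mul, ← pow_add]
    congr 1
    omega
  have htrace : Algebra.trace (ZMod 3) K (c * (t ^ n) ^ 6) = T := by
    apply (algebraMap (ZMod 3) K).injective
    rw [FiniteField.algebraMap_trace_eq_sum_pow, hfr, Nat.card_zmod, map_intCast, ← htr]
    ring_nf
  have E : {P : K × K // P.2 ^ 2 = P.1 ^ 3 - t ^ 2 * P.1 + c} ≃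
      {P : K × K // P.2 ^ 2 = P.1 ^ 3 - P.1 + c * (t ^ n) ^ 6} :=
    ((Equiv.mulLeft₀ _ (pow_ne_zero 2 hw)).prodCongr
      (Equiv.mulLeft₀ _ (pow_ne_zero 3 hw))).subtypeEquiv fun P => by
        rw [← mul_right_inj' (pow_ne_zero 6 hw)]
        simp only [Equiv.prodCongr_apply, Prod.map, Equiv.mulLeft₀_apply]
        constructor
        · intro h
          linear_combination h - (t ^ n) ^ 2 * P.1 * hone
        · intro h
          linear_combination h + (t ^ n) ^ 2 * P.1 * hone
  rw [Nat.card_congr E, card_artinSchreier_curve hfr hT htrace, hK,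
    show (2 * m + 1 + 1) / 2 = m + 1 by omega]
  ring
end

section
/- Let q = 3^d with d odd, let K be a finite field with q elements, and let b, c ∈ K with b a nonsquare (in particular b ≠ 0). Then the number of pairs (x, y) ∈ K × K with y^2 = x^3 − bx + c equals q. (Equivalently, the elliptic curve y^2 = x^3 − bx + c over F_q has trace of Frobenius 0.) -/
theorem three_eq_zero_of_card_eq_three_pow {K : Type*} [Field K] [Fintype K] {d : ℕ}
    (hK : Fintype.card K = 3 ^ d) : (3 : K) = 0 := by
  have h : ((Fintype.card K : ℕ) : K) = 0 := Nat.cast_card_eq_zero K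
  rw [hK] at h
  push_cast at h
  exact eq_zero_of_pow_eq_zero h

theorem injective_cube_sub_mul_of_three_eq_zero {K : Type*} [Field K] (h3 : (3 : K) = 0) {b : K}
    (hb : ¬∃ s : K, b = s ^ 2) : Function.Injective fun x : K => x ^ 3 - b * x := by
  intro x y hxy
  have h : (x - y) * ((x - y) ^ 2 - b) = 0 := by
    linear_combination hxy - x * y * (x - y) * h3
  rcases mul_eq_zero.mp h with h | h
  · exact sub_eq_zero.mp h
  · exact absurd ⟨x - y, (sub_eq_zero.mp h).symm⟩ hb

/-- Point counts for supersingular elliptic curves `y² = x³ - bx + c` over `F_q`,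
`q = 3^d` with `d` odd, when `b` is a nonsquare: the number of affine points is `q`
(the trace of Frobenius is 0). -/
theorem stmt_14 (d : ℕ) (hd : Odd d) (q : ℕ) (hq : q = 3 ^ d)
    (K : Type*) [Field K] [Fintype K] (hK : Fintype.card K = q)
    (b c : K) (hb : ¬∃ s : K, b = s ^ 2) :
    Nat.card {P : K × K // P.2 ^ 2 = P.1 ^ 3 - b * P.1 + c} = q := by
  have hbij : Function.Bijective fun x : K => x ^ 3 - b * x :=
    Finite.injective_iff_bijective.mp (injective_cube_sub_mul_of_three_eq_zero
      (three_eq_zero_of_card_eq_three_pow (hK.trans hq)) hb)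
  rw [← hK, ← Nat.card_eq_fintype_card]
  refine Nat.card_eq_of_bijective
    (fun P : {P : K × K // P.2 ^ 2 = P.1 ^ 3 - b * P.1 + c} => P.1.2) ⟨?_, fun y => ?_⟩
  · rintro ⟨⟨x, y⟩, hxy⟩ ⟨⟨x', y'⟩, hxy'⟩ rfl
    have hx : x = x' := hbij.injective (add_right_cancel (hxy.symm.trans hxy'))
    subst hx
    rfl
  · obtain ⟨x, hx⟩ := hbij.surjective (y ^ 2 - c)
    exact ⟨⟨(x, y), sub_eq_iff_eq_add.mp hx.symm⟩, rfl⟩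
end

section
/- Let q = 3^d with d even and positive, let K be a finite field with q elements, and let b, c ∈ K with b = u^4 for some nonzero u ∈ K. If Tr_{K/F_3}(c·u^{−6}) = 0, then the number of pairs (x, y) ∈ K × K with y^2 = x^3 − bx + c equals q − 2·(−3)^{d/2}. (Equivalently, the elliptic curve y^2 = x^3 − bx + c over F_q has trace of Frobenius 2·(−3)^{d/2}.) -/
open Finset Polynomial in
/-- In characteristic three, an element of trace zero has the form `z³ - z`. -/
theorem exists_cube_sub_self_eq_of_trace_eq_zero {K : Type*} [Field K] [Fintype K] [CharP K 3]
    {d : ℕ} (hd : 0 < d) (hK : Fintype.card K = 3 ^ d) (a : K)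
    (ha : ∑ i ∈ range d, a ^ 3 ^ i = 0) : ∃ z : K, z ^ 3 - z = a := by
  classical
  have : Fact (Nat.Prime 3) := ⟨Nat.prime_three⟩
  let f : K →+ K := (frobenius K 3 : K →+ K) - AddMonoidHom.id K
  have hf (z : K) : f z = z ^ 3 - z := rfl
  have hker : Nat.card f.ker ≤ 3 := by
    have hdeg := FiniteField.X_pow_card_sub_X_natDegree_eq K (p := 3) (by norm_num)
    have h := card_le_degree_of_subset_roots (p := (X ^ 3 - X : K[X]))
      (Z := {z : K | z ^ 3 - z = 0}) (by
        intro z hz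
        rw [mem_roots (FiniteField.X_pow_card_sub_X_ne_zero K (by norm_num))]
        simpa using hz)
    rw [hdeg] at h
    rw [← SetLike.coe_sort_coe, Nat.card_coe_set_eq, ← Set.ncard_coe_finset] at *
    convert h using 2
    ext z
    simp [AddMonoidHom.mem_ker, hf]
  let P : K[X] := ∑ i ∈ range d, X ^ 3 ^ i
  have hP : P ≠ 0 := by
    intro h
    have h1 : P.coeff 1 = 1 := by
      simp only [P, finsetSum_coeff, coeff_X_pow]
      rw [sum_eq_single 0]
      · simp
      · intro i _ hi
        rw [if_neg]
        exact fun h ↦ (Nat.one_lt_pow hi (by norm_num : 1 < 3)).ne h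
      · simp [hd.ne']
    simp [h] at h1
  have hPdeg : P.natDegree ≤ 3 ^ (d - 1) := by
    refine natDegree_sum_le_of_forall_le _ _ fun i hi ↦ ?_
    rw [natDegree_X_pow]
    exact Nat.pow_le_pow_right (by norm_num) (by have := mem_range.1 hi; omega)
  let S : Finset K := {x : K | ∑ i ∈ range d, x ^ 3 ^ i = 0}
  have hS : #S ≤ 3 ^ (d - 1) := by
    refine (card_le_degree_of_subset_roots (p := P) ?_).trans hPdeg
    intro z hz
    rw [mem_roots hP]
    simpa [S, P, eval_finsetSum] using hz
  let R : Finset K := univ.image f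
  have hRS : R ⊆ S := by
    intro x hx
    obtain ⟨z, -, rfl⟩ := mem_image.1 hx
    simp only [S, mem_filter, mem_univ, true_and, hf, sub_pow_char_pow]
    simp_rw [← pow_mul, ← pow_succ']
    rw [sum_range_sub (fun i ↦ z ^ 3 ^ i), ← hK, FiniteField.pow_card]
    simp
  have hR : 3 ^ (d - 1) ≤ #R := by
    have h := f.ker.card_mul_index
    have hr : Nat.card f.range = #R := by
      rw [← SetLike.coe_sort_coe, Nat.card_coe_set_eq, ← Set.ncard_coe_finset]
      simp [R]
    rw [AddSubgroup.index_ker, hr, Nat.card_eq_fintype_card (α := K), hK] at h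
    obtain ⟨e, rfl⟩ : ∃ e, d = e + 1 := ⟨d - 1, by omega⟩
    rw [pow_succ] at h
    simp only [Nat.add_sub_cancel]
    nlinarith
  have haR : a ∈ R := by
    rw [eq_of_subset_of_card_le hRS (hS.trans hR)]
    simpa [S] using ha
  obtain ⟨z, -, hz⟩ := mem_image.1 haR
  exact ⟨z, hz⟩

open Finset in
theorem FiniteField.card_filter_pow_eq_one {K : Type*} [Field K] [Fintype K] [DecidableEq K]
    {n : ℕ} (hn : 0 < n) (h : n ∣ Fintype.card K - 1) : #{x : K | x ^ n = 1} = n := by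
  obtain ⟨g, hg⟩ := IsCyclic.exists_generator (α := Kˣ)
  have hord : orderOf g = Fintype.card K - 1 := by
    rw [orderOf_eq_card_of_forall_mem_zpowers hg, Nat.card_eq_fintype_card, Fintype.card_units]
  have hg' : IsPrimitiveRoot (g : K) (Fintype.card K - 1) := by
    rw [IsPrimitiveRoot.coe_units_iff, ← hord]
    exact IsPrimitiveRoot.orderOf g
  obtain ⟨k, hk⟩ := h
  have hprim := hg'.pow (by have := Fintype.one_lt_card (α := K); omega) (hk.trans (mul_comm n k))
  refine Eq.trans (congrArg Finset.card ?_) hprim.card_nthRootsFinset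
  ext x
  simp [Polynomial.mem_nthRootsFinset hn]

open Finset in
/-- The trace `x ↦ x + σ x` of an involution `σ` maps the points of `y² = x³ - x` bijectively onto
the pairs `(s, y)` with `σ s = s` and `y² + σ (y²) = s³ - s`. -/
theorem card_cube_sub_self_eq_card_fixed {K : Type*} [Field K] [Fintype K] [DecidableEq K]
    [CharP K 3] (σ : K →+* K) (hσ : ∀ x, σ (σ x) = x) :
    #{P : K × K | P.2 ^ 2 = P.1 ^ 3 - P.1} =
      #{P : K × K | σ P.1 = P.1 ∧ P.2 ^ 2 + σ P.2 ^ 2 = P.1 ^ 3 - P.1} := by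
  have : Fact (Nat.Prime 3) := ⟨Nat.prime_three⟩
  have h3 : (3 : K) = 0 := by exact_mod_cast CharP.cast_eq_zero K 3
  -- `w ↦ w³ - w` is bijective on the elements with `σ w = -w`
  have hinj (w : K) (hw : σ w = -w) (h0 : w ^ 3 - w = 0) : w = 0 := by
    have hf : w * ((w - 1) * (w + 1)) = 0 := by linear_combination h0
    rcases mul_eq_zero.1 hf with h | h
    · exact h
    rcases mul_eq_zero.1 h with h | h
    · have : w = 1 := by linear_combination h
      subst this
      rw [map_one] at hw
      linear_combination h3 - hw
    · have : w = -1 := by linear_combination h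
      subst this
      rw [map_neg, map_one] at hw
      linear_combination -hw - h3
  let A : Finset K := {w : K | σ w = -w}
  have hsurj : Set.SurjOn (fun w : K ↦ w ^ 3 - w) A A := by
    refine Finset.surjOn_of_injOn_of_card_le _ ?_ ?_ le_rfl
    · intro w hw
      simp only [A, coe_filter, mem_univ, true_and, Set.mem_ofPred_eq, map_sub, map_pow] at hw ⊢
      rw [hw]; ring
    · intro v hv w hw h
      simp only [A, coe_filter, mem_univ, true_and, Set.mem_ofPred_eq] at hv hw h
      refine sub_eq_zero.1 (hinj (v - w) (by rw [map_sub, hv, hw]; ring) ?_)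
      linear_combination h - (v - w) * v * w * h3
  refine card_bij (fun P _ ↦ (P.1 + σ P.1, P.2)) ?_ ?_ ?_
  · rintro ⟨x, y⟩ h
    simp only [mem_filter, mem_univ, true_and] at h ⊢
    refine ⟨by rw [map_add, hσ, add_comm], ?_⟩
    rw [← map_pow, h, map_sub, map_pow]
    linear_combination -(x + σ x) * x * σ x * h3
  · rintro ⟨x, y⟩ h ⟨x', y'⟩ h' heq
    simp only [mem_filter, mem_univ, true_and, Prod.mk.injEq] at h h' heq
    obtain ⟨hs, rfl⟩ := heq
    refine Prod.ext (sub_eq_zero.1 (hinj (x - x') ?_ ?_)) rfl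
    · rw [map_sub]; linear_combination hs
    · linear_combination h' - h - (x - x') * x * x' * h3
  · rintro ⟨s, y⟩ h
    simp only [mem_filter, mem_univ, true_and] at h
    obtain ⟨hs, hy⟩ := h
    obtain ⟨w, hw, hwv⟩ := hsurj (show y ^ 2 + (s ^ 3 - s) ∈ (A : Set K) by
      simp only [A, coe_filter, mem_univ, true_and, Set.mem_ofPred_eq, map_add, map_sub, map_pow, hs]
      linear_combination hy + (s ^ 3 - s) * h3)
    simp only [A, coe_filter, mem_univ, true_and, Set.mem_ofPred_eq] at hw hwv
    refine ⟨(w - s, y), ?_, ?_⟩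
    · simp only [mem_filter, mem_univ, true_and]
      linear_combination -hwv + (w - s) * w * s * h3
    · simp only [map_sub, hw, hs, Prod.mk.injEq, and_true]
      linear_combination -s * h3

open Finset in
theorem card_sq_eq_cube_sub_self {K : Type*} [Field K] [Fintype K] [DecidableEq K] [CharP K 3]
    {m : ℕ} (hm : 0 < m) (hK : Fintype.card K = 3 ^ (2 * m)) :
    (#{P : K × K | P.2 ^ 2 = P.1 ^ 3 - P.1} : ℤ) = 3 ^ (2 * m) - 2 * (-3) ^ m := by
  have : Fact (Nat.Prime 3) := ⟨Nat.prime_three⟩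
  have h3 : (3 : K) = 0 := by exact_mod_cast CharP.cast_eq_zero K 3
  have h2 : (2 : K) ≠ 0 := fun h ↦ one_ne_zero (α := K) (by linear_combination h3 - h)
  let σ : K →+* K := iterateFrobenius K 3 m
  obtain ⟨Q, hQ⟩ : ∃ Q : ℕ, Q = 3 ^ m := ⟨_, rfl⟩
  have hQ1 : 3 ≤ Q := hQ ▸ (Nat.le_self_pow hm.ne' 3)
  have hσ' (x : K) : σ x = x ^ Q := by rw [hQ]; exact iterateFrobenius_def 3 m x
  have hKQ : Fintype.card K = Q * Q := by rw [hK, hQ]; ring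
  have hσ (x : K) : σ (σ x) = x := by
    rw [hσ', hσ', ← pow_mul, ← hKQ, FiniteField.pow_card]
  obtain ⟨k, hk⟩ : ∃ k, Q = 2 * k + 1 := by
    have : Odd Q := hQ ▸ Odd.pow (by decide)
    exact this
  have hcard1 : Fintype.card K - 1 = 2 * k * (2 * (k + 1)) := by
    rw [hKQ, hk, Nat.sub_eq_of_eq_add]; ring
  have hpow (x : K) (hx : x ≠ 0) : x ^ (2 * k * (2 * (k + 1))) = 1 := by
    rw [← hcard1, FiniteField.pow_card_sub_one_eq_one x hx]
  have hfix (x : K) (hx : x ≠ 0) : σ x = x ↔ x ^ (2 * k) = 1 := by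
    rw [hσ', hk, pow_succ]
    exact ⟨fun h ↦ mul_right_cancel₀ hx (by rw [h, one_mul]), fun h ↦ by rw [h, one_mul]⟩
  -- the fixed field of `σ`
  let F : Finset K := {s : K | σ s = s}
  have hF : #F = Q := by
    have : F = insert 0 ({s : K | s ^ (2 * k) = 1} : Finset K) := by
      ext x
      by_cases hx : x = 0
      · simp [F, hx]
      · simp [F, hx, hfix]
    rw [this, card_insert_of_notMem (by simp [show k ≠ 0 by omega]),
      FiniteField.card_filter_pow_eq_one (by omega) (hcard1 ▸ Dvd.intro _ rfl), hk]
  let T (y : K) : K := y ^ 2 + σ y ^ 2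
  let N (t : K) : ℕ := #{y : K | T y = t}
  have hTF (y : K) : T y ∈ F := by
    simp only [F, T, mem_filter, mem_univ, true_and, map_add, map_pow, hσ]
    ring
  have hN (t : K) (ht : t ∈ F) (ht0 : t ≠ 0) : N t = N 1 := by
    simp only [F, mem_filter, mem_univ, true_and] at ht
    obtain ⟨s, hs⟩ : IsSquare t := by
      rw [FiniteField.isSquare_iff (fun h ↦ h2 ?_) ht0]
      · rw [show Fintype.card K / 2 = 2 * k * (k + 1) by
          have : Fintype.card K = 2 * (2 * k * (k + 1)) + 1 := by rw [hKQ, hk]; ring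
          omega, pow_mul, (hfix t ht0).1 ht, one_pow]
      · have := ringChar.Nat.cast_ringChar (R := K)
        rw [h] at this
        exact_mod_cast this
    have hs0 : s ≠ 0 := by rintro rfl; simp [hs] at ht0
    have hTs (y : K) : T (s * y) = t * T y := by
      simp only [T, map_mul]
      have : σ s * σ s = t := by rw [← map_mul, ← hs, ht]
      linear_combination σ y ^ 2 * this - y ^ 2 * hs
    symm
    refine card_bij (fun y _ ↦ s * y) ?_ ?_ ?_
    · intro y hy
      simp only [mem_filter, mem_univ, true_and] at hy ⊢
      rw [hTs, hy, mul_one]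
    · intro y _ z _ h
      exact mul_left_cancel₀ hs0 h
    · intro y hy
      simp only [mem_filter, mem_univ, true_and] at hy ⊢
      refine ⟨s⁻¹ * y, ?_, by field_simp⟩
      refine mul_left_cancel₀ ht0 ?_
      rw [← hTs, mul_inv_cancel_left₀ hs0, hy, mul_one]
  have h0F : (0 : K) ∈ F := by simp [F]
  have hsum : Q * Q = N 0 + 2 * k * N 1 := by
    have h := card_eq_sum_card_fiberwise (f := T) (s := univ) (t := F) (fun y _ ↦ hTF y)
    rw [card_univ, hKQ, ← add_sum_erase _ _ h0F] at h
    rw [h, sum_congr rfl (fun t ht ↦ hN t (mem_of_mem_erase ht) (ne_of_mem_erase ht)),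
      sum_const, card_erase_of_mem h0F, hF, hk, smul_eq_mul, Nat.add_sub_cancel]
  let G : Finset K := {s : K | s ^ 3 - s = 0}
  have hGcard : #G = 3 := by
    have : G = insert 0 ({s : K | s ^ 2 = 1} : Finset K) := by
      ext s
      by_cases hs : s = 0
      · simp [G, hs]
      · simp only [G, mem_filter, mem_univ, true_and, mem_insert, hs, false_or]
        rw [show s ^ 3 - s = s * (s ^ 2 - 1) by ring, mul_eq_zero, or_iff_right hs, sub_eq_zero]
    rw [this, card_insert_of_notMem (by simp),
      FiniteField.card_filter_pow_eq_one two_pos (hcard1 ▸ ⟨k * (2 * (k + 1)), by ring⟩)]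
  have hGF : G ⊆ F := by
    intro s hs
    simp only [G, F, mem_filter, mem_univ, true_and] at hs ⊢
    rw [hσ', hQ]
    clear * - hs
    induction m with
    | zero => simp
    | succ m ih => rw [pow_succ, pow_mul, ih, sub_eq_zero.1 hs]
  have hcount : #{P : K × K | P.2 ^ 2 = P.1 ^ 3 - P.1} = 3 * N 0 + (Q - 3) * N 1 := by
    rw [card_cube_sub_self_eq_card_fixed σ hσ,
      card_eq_sum_card_fiberwise (f := Prod.fst) (t := F) (by intro P hP; simp_all [F])]
    have hfib (s : K) (hs : s ∈ F) :
        #{P ∈ ({P : K × K | σ P.1 = P.1 ∧ P.2 ^ 2 + σ P.2 ^ 2 = P.1 ^ 3 - P.1} :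
          Finset (K × K)) | P.1 = s} = N (s ^ 3 - s) := by
      simp only [F, mem_filter, mem_univ, true_and] at hs
      refine card_bij (fun P _ ↦ P.2) ?_ ?_ ?_
      · rintro ⟨x, y⟩ h
        simp only [mem_filter, mem_univ, true_and] at h
        obtain ⟨⟨-, h⟩, rfl⟩ := h
        simpa [T] using h
      · rintro ⟨x, y⟩ h ⟨x', y'⟩ h' heq
        simp only [mem_filter, mem_univ, true_and] at h h' heq
        rw [h.2, h'.2, heq]
      · intro y hy
        simp only [mem_filter, mem_univ, true_and] at hy
        exact ⟨(s, y), by simpa [hs] using hy, rfl⟩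
    rw [sum_congr rfl hfib, ← sum_sdiff hGF, add_comm]
    congr 1
    · rw [sum_congr rfl (g := fun _ ↦ N 0), sum_const, hGcard, smul_eq_mul]
      intro s hs
      rw [(mem_filter.1 hs).2]
    · rw [sum_congr rfl (g := fun _ ↦ N 1), sum_const, card_sdiff_of_subset hGF, hF, hGcard,
        smul_eq_mul]
      intro s hs
      rw [mem_sdiff] at hs
      refine hN _ ?_ fun h ↦ hs.2 (by simp [G, h])
      have := (mem_filter.1 hs.1).2
      simp [F, this]
  have hT0 (y : K) (hy : y ≠ 0) : T y = 0 ↔ y ^ (4 * k) = -1 := by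
    have : T y = y ^ 2 * (y ^ (4 * k) + 1) := by
      simp only [T, hσ', hk]; ring
    rw [this, mul_eq_zero, or_iff_right (pow_ne_zero 2 hy), eq_neg_iff_add_eq_zero]
  have hT00 : T 0 = 0 := by simp [T]
  have hNpos : N 0 = 1 + #{y : K | y ^ (4 * k) = -1} := by
    have : ({y : K | T y = 0} : Finset K) =
        insert 0 ({y : K | y ^ (4 * k) = -1} : Finset K) := by
      ext y
      by_cases hy : y = 0
      · simp [hy, hT00]
      · simp [hy, hT0]
    simp only [N]
    rw [this, card_insert_of_notMem, add_comm]
    have : 4 * k ≠ 0 := by omega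
    simp [this]
  have hne : (1 : K) ≠ -1 := fun h ↦ h2 (by linear_combination h)
  have hKz : (3 : ℤ) ^ (2 * m) = Q * Q := by rw [hQ]; push_cast; ring
  rw [hcount, hKz]
  rcases Nat.even_or_odd m with hme | hmo
  · have hk2 : Even k := by
      have h : Q % 4 = 1 := by
        obtain ⟨j, rfl⟩ := hme
        rw [hQ, ← two_mul, pow_mul, Nat.pow_mod]; simp
      rw [Nat.even_iff]; omega
    have hempty : ({y : K | y ^ (4 * k) = -1} : Finset K) = ∅ := by
      refine filter_eq_empty_iff.2 fun y _ hy ↦ hne ?_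
      have hy0 : y ≠ 0 := by
        rintro rfl
        rw [zero_pow (by omega)] at hy
        exact one_ne_zero (α := K) (by linear_combination hy)
      have h := hpow y hy0
      rw [show 2 * k * (2 * (k + 1)) = 4 * k * (k + 1) by ring, pow_mul, hy,
        hk2.add_one.neg_one_pow] at h
      exact h.symm
    rw [hempty, card_empty] at hNpos
    have hN1 : N 1 = Q + 1 := by
      have : 2 * k * N 1 = 2 * k * (Q + 1) := by rw [hk] at hsum ⊢; rw [hNpos] at hsum; linarith
      exact Nat.eq_of_mul_eq_mul_left (by omega) this
    rw [hNpos, hN1, hme.neg_pow, show (3 : ℤ) ^ m = Q by rw [hQ]; push_cast; rfl]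
    push_cast [Nat.cast_sub hQ1]
    ring
  · have hk2 : Odd k := by
      have h : Q % 4 = 3 := by
        obtain ⟨j, rfl⟩ := hmo
        rw [hQ, pow_succ, pow_mul, Nat.mul_mod, Nat.pow_mod]; simp
      rw [Nat.odd_iff]; omega
    obtain ⟨j, hj⟩ := hk2
    have hcard4 : #{y : K | y ^ (4 * k) = -1} = 4 * k := by
      have h8 := FiniteField.card_filter_pow_eq_one (K := K) (n := 8 * k) (by omega)
        ⟨j + 1, by rw [hcard1, show k + 1 = 2 * (j + 1) by omega]; ring⟩
      have h4 := FiniteField.card_filter_pow_eq_one (K := K) (n := 4 * k) (by omega)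
        ⟨k + 1, by rw [hcard1]; ring⟩
      have hdisj : Disjoint ({y : K | y ^ (4 * k) = 1} : Finset K)
          ({y : K | y ^ (4 * k) = -1} : Finset K) := by
        refine disjoint_filter.2 fun y _ h h' ↦ hne (h.symm.trans h')
      have hunion : ({y : K | y ^ (8 * k) = 1} : Finset K) =
          ({y : K | y ^ (4 * k) = 1} : Finset K) ∪ ({y : K | y ^ (4 * k) = -1} : Finset K) := by
        ext y
        simp only [mem_filter, mem_univ, true_and, mem_union]
        rw [show 8 * k = 4 * k * 2 by ring, pow_mul, sq_eq_one_iff]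
      rw [hunion, card_union_of_disjoint hdisj] at h8
      omega
    rw [hcard4] at hNpos
    have hN1 : N 1 = 2 * k := by
      have : 2 * k * N 1 = 2 * k * (2 * k) := by
        rw [hk] at hsum; rw [hNpos] at hsum; linarith
      exact Nat.eq_of_mul_eq_mul_left (by omega) this
    rw [hNpos, hN1, hmo.neg_pow, show (3 : ℤ) ^ m = Q by rw [hQ]; push_cast; rfl]
    push_cast [Nat.cast_sub hQ1]
    rw [hk]
    push_cast
    ring

/-- Point counts for supersingular elliptic curves `y² = x³ - bx + c` over `F_q`,
`q = 3^d` with `d` even and positive, when `b = u⁴` is a fourth power and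
`Tr_{F_q/F_3}(c·u⁻⁶) = 0`: the number of affine points is `q - 2·(-3)^(d/2)`
(the trace of Frobenius is `2·(-3)^(d/2)`). -/
theorem stmt_15 (d : ℕ) (hd : Even d) (hd0 : 0 < d) (q : ℕ) (hq : q = 3 ^ d)
    (K : Type*) [Field K] [Fintype K] (hK : Fintype.card K = q)
    (b c u : K) (hu : u ≠ 0) (hb : b = u ^ 4)
    (htr : ∑ i ∈ Finset.range d, (c * u⁻¹ ^ 6) ^ 3 ^ i = 0) :
    (Nat.card {P : K × K // P.2 ^ 2 = P.1 ^ 3 - b * P.1 + c} : ℤ)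
      = (q : ℤ) - 2 * (-3) ^ (d / 2) := by
  classical
  subst hq
  have : Fact (Nat.Prime 3) := ⟨Nat.prime_three⟩
  have : CharP K 3 := charP_of_card_eq_prime_pow hK
  have h3 : (3 : K) = 0 := by exact_mod_cast CharP.cast_eq_zero K 3
  obtain ⟨z, hz⟩ := exists_cube_sub_self_eq_of_trace_eq_zero hd0 hK _ htr
  obtain ⟨m, rfl⟩ := hd
  rw [← two_mul] at hK hd0 ⊢
  rw [Nat.mul_div_cancel_left m two_pos]
  push_cast
  rw [← card_sq_eq_cube_sub_self (by omega) hK, Nat.card_eq_fintype_card, Fintype.card_subtype]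
  have hc : c = u ^ 6 * (z ^ 3 - z) := by rw [hz]; field_simp
  congr 1
  refine Finset.card_bij (fun P _ ↦ (P.1 / u ^ 2 + z, P.2 / u ^ 3)) ?_ ?_ ?_
  · rintro ⟨x, y⟩ h
    simp only [Finset.mem_filter, Finset.mem_univ, true_and] at h ⊢
    have h' : (x / u ^ 2 + z) ^ 3 - (x / u ^ 2 + z) =
        (x / u ^ 2) ^ 3 - x / u ^ 2 + (z ^ 3 - z) := by
      rw [add_pow_char]; ring
    rw [h', div_pow, h, hb, hc]
    field_simp
  · rintro ⟨x, y⟩ _ ⟨x', y'⟩ _ h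
    simp only [Prod.mk.injEq, add_left_inj] at h
    exact Prod.ext ((div_left_inj' (pow_ne_zero 2 hu)).1 h.1)
      ((div_left_inj' (pow_ne_zero 3 hu)).1 h.2)
  · rintro ⟨x, y⟩ h
    simp only [Finset.mem_filter, Finset.mem_univ, true_and] at h
    refine ⟨((x - z) * u ^ 2, y * u ^ 3), ?_, ?_⟩
    · simp only [Finset.mem_filter, Finset.mem_univ, true_and]
      rw [hb, hc]
      linear_combination u ^ 6 * h + u ^ 6 * x * z * (x - z) * h3
    · ext <;> simp [hu]
end

section
/- Let q = 3^d with d even and positive, let K be a finite field with q elements, and let b, c ∈ K with b = u^4 for some nonzero u ∈ K. If Tr_{K/F_3}(c·u^{−6}) ≠ 0, then the number of pairs (x, y) ∈ K × K with y^2 = x^3 − bx + c equals q + (−3)^{d/2}. (Equivalently, the elliptic curve y^2 = x^3 − bx + c over F_q has trace of Frobenius −(−3)^{d/2}.) -/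
section Exactness

variable {G : Type*} [AddCommGroup G] [Finite G]

/-- If `f ∘ g = 0` and the kernels of `g` and `f` are as small as the order of `G` permits, then
`range g = ker f` and both bounds are attained. -/
theorem range_eq_ker_of_card_ker_le {f g : G →+ G} {m n : ℕ} (hfg : ∀ x, f (g x) = 0)
    (hg : Nat.card g.ker ≤ m) (hf : Nat.card f.ker ≤ n) (hG : Nat.card G = m * n) :
    g.range = f.ker ∧ Nat.card g.ker = m ∧ Nat.card f.ker = n := by
  have hle : g.range ≤ f.ker := by
    rintro _ ⟨x, rfl⟩
    exact hfg x
  have hcard : Nat.card g.range ≤ Nat.card f.ker := AddSubgroup.card_le_of_le hle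
  have hmul : Nat.card g.ker * Nat.card g.range = m * n := by
    rw [← hG, ← AddSubgroup.card_mul_index g.ker, AddSubgroup.index_ker]
  have hpos : 0 < m * n := hG ▸ Nat.card_pos
  have hm : 0 < m := Nat.pos_of_mul_pos_right hpos
  have hn : 0 < n := Nat.pos_of_mul_pos_left hpos
  have hk : Nat.card g.ker = m := by
    refine le_antisymm hg (Nat.le_of_mul_le_mul_right (c := n) ?_ hn)
    rw [← hmul]
    exact Nat.mul_le_mul_left _ (hcard.trans hf)
  have hr : Nat.card g.range = n := by
    rw [hk] at hmul
    exact Nat.eq_of_mul_eq_mul_left hm hmul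
  have hf' : Nat.card f.ker = n := le_antisymm hf (hr ▸ hcard)
  exact ⟨AddSubgroup.eq_of_le_of_card_ge hle (by rw [hf', hr]), hk, hf'⟩

theorem card_ker_comp_le (f g : G →+ G) :
    Nat.card (f.comp g).ker ≤ Nat.card g.ker * Nat.card f.ker := by
  let h : (f.comp g).ker →+ f.ker :=
    (g.comp (f.comp g).ker.subtype).codRestrict f.ker fun x => x.2
  have hker : Nat.card h.ker ≤ Nat.card g.ker := by
    refine Nat.card_le_card_of_injective
      (fun x => (⟨x.1.1, congrArg Subtype.val x.2⟩ : g.ker)) fun x y hxy => ?_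
    exact Subtype.ext (Subtype.ext (Subtype.mk.inj hxy))
  rw [← AddSubgroup.card_mul_index h.ker, AddSubgroup.index_ker]
  exact Nat.mul_le_mul hker h.range.card_le_card_addGroup

end Exactness

open Polynomial in
theorem card_addMonoidHom_ker_le_natDegree {K : Type*} [Field K] {f : K →+ K} {p : K[X]}
    (hp : p ≠ 0) (hf : ∀ x, p.eval x = f x) : Nat.card f.ker ≤ p.natDegree := by
  classical
  have h : (f.ker : Set K) = (p.roots.toFinset : Set K) := by
    ext x
    simp [hp, hf, AddMonoidHom.mem_ker]
  calc Nat.card f.ker = Set.ncard (f.ker : Set K) := rfl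
    _ = p.roots.toFinset.card := by rw [h, Set.ncard_coe_finset]
    _ ≤ p.roots.card := p.roots.toFinset_card_le
    _ ≤ p.natDegree := p.card_roots'

theorem pow_three_pow_eq_self {K : Type*} [Field K] [Finite K] {d : ℕ} (hK : Nat.card K = 3 ^ d)
    (x : K) : x ^ 3 ^ d = x := by
  have := Fintype.ofFinite K
  rw [← hK, Nat.card_eq_fintype_card, FiniteField.pow_card]

theorem card_filter_eq_zero {K : Type*} [Field K] [Fintype K] [DecidableEq K] (f : K →+ K) :
    (Finset.univ.filter fun x => f x = 0).card = Nat.card f.ker := by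
  rw [Nat.card_eq_fintype_card, Fintype.card_subtype]
  simp [AddMonoidHom.mem_ker]

section CharThree

variable (K : Type*) [Field K] [CharP K 3]

/-- The additive map `x ↦ x + x³ + ⋯ + x^(3^(n-1))`. -/
def frobeniusSum (n : ℕ) : K →+ K :=
  ∑ i ∈ Finset.range n, (iterateFrobenius K 3 i).toAddMonoidHom

/-- The additive map `x ↦ x^(3^n) - x`. -/
def frobeniusSub (n : ℕ) : K →+ K :=
  (iterateFrobenius K 3 n).toAddMonoidHom - AddMonoidHom.id K

/-- The additive map `x ↦ x^(3^n) + x`. -/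
def frobeniusAdd (n : ℕ) : K →+ K :=
  (iterateFrobenius K 3 n).toAddMonoidHom + AddMonoidHom.id K

variable {K}

theorem frobeniusSum_apply (n : ℕ) (x : K) :
    frobeniusSum K n x = ∑ i ∈ Finset.range n, x ^ 3 ^ i := by
  simp [frobeniusSum, iterateFrobenius_def]

theorem frobeniusSub_apply (n : ℕ) (x : K) : frobeniusSub K n x = x ^ 3 ^ n - x := by
  simp [frobeniusSub, iterateFrobenius_def]

theorem frobeniusAdd_apply (n : ℕ) (x : K) : frobeniusAdd K n x = x ^ 3 ^ n + x := by
  simp [frobeniusAdd, iterateFrobenius_def]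

theorem frobeniusSum_pow_three (n : ℕ) (x : K) :
    frobeniusSum K n x ^ 3 = frobeniusSum K n (x ^ 3) := by
  rw [frobeniusSum_apply, frobeniusSum_apply, sum_pow_char 3]
  simp_rw [← pow_mul, mul_comm]

theorem frobeniusSum_pow_three_sub (n : ℕ) (x : K) :
    frobeniusSum K n (x ^ 3) - frobeniusSum K n x = x ^ 3 ^ n - x := by
  rw [frobeniusSum_apply, frobeniusSum_apply, ← Finset.sum_sub_distrib]
  have := Finset.sum_range_sub (fun i => x ^ 3 ^ i) n
  simp only [pow_zero, pow_one] at this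
  rw [← this]
  refine Finset.sum_congr rfl fun i _ => ?_
  rw [← pow_mul, ← pow_succ']

theorem card_ker_frobeniusSub_le {n : ℕ} (hn : 0 < n) :
    Nat.card (frobeniusSub K n).ker ≤ 3 ^ n := by
  have h1 : 1 < 3 ^ n := Nat.one_lt_pow hn.ne' (by norm_num)
  rw [← FiniteField.X_pow_card_sub_X_natDegree_eq K h1]
  exact card_addMonoidHom_ker_le_natDegree (FiniteField.X_pow_card_sub_X_ne_zero K h1)
    fun x => by simp [frobeniusSub_apply]

open Polynomial in
theorem card_ker_frobeniusAdd_le {n : ℕ} (hn : 0 < n) :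
    Nat.card (frobeniusAdd K n).ker ≤ 3 ^ n := by
  have h1 : 1 < 3 ^ n := Nat.one_lt_pow hn.ne' (by norm_num)
  have hd : (X ^ 3 ^ n + X : K[X]).natDegree = 3 ^ n := by
    rw [natDegree_add_eq_left_of_natDegree_lt] <;> simp [h1]
  refine (card_addMonoidHom_ker_le_natDegree (p := (X ^ 3 ^ n + X : K[X])) ?_
    fun x => by simp [frobeniusAdd_apply]).trans hd.le
  rintro h
  have : 0 < 3 ^ n := by positivity
  rw [h, natDegree_zero] at hd
  omega

open Polynomial in
theorem card_ker_frobeniusSum_le {n : ℕ} (hn : 0 < n) :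
    Nat.card (frobeniusSum K n).ker ≤ 3 ^ (n - 1) := by
  set p : K[X] := ∑ i ∈ Finset.range n, X ^ 3 ^ i with hp
  have hdeg : p.natDegree ≤ 3 ^ (n - 1) := by
    refine natDegree_sum_le_of_forall_le _ _ fun i hi => ?_
    rw [natDegree_X_pow]
    exact Nat.pow_le_pow_right (by norm_num) (by have := Finset.mem_range.mp hi; omega)
  refine (card_addMonoidHom_ker_le_natDegree (p := p) ?_ fun x => ?_).trans hdeg
  · intro h
    have h1 : p.coeff 1 = 1 := by
      rw [hp, finsetSum_coeff, Finset.sum_eq_single_of_mem 0 (Finset.mem_range.mpr hn)]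
      · simp
      · intro i _ hi
        rw [coeff_X_pow, if_neg (Nat.one_lt_pow hi (by norm_num)).ne]
    simp [h] at h1
  · simp [hp, frobeniusSum_apply, eval_finsetSum]

variable (K) in
theorem ringChar_ne_two_of_charP_three : ringChar K ≠ 2 := by
  rw [ringChar.eq K 3]
  norm_num

theorem frobeniusSum_two_mul_mul {m : ℕ} {a : K} (ha : a ^ 3 ^ m = a) (x : K) :
    frobeniusSum K (2 * m) (a * x) = frobeniusSum K m (a * frobeniusAdd K m x) := by
  have : a * frobeniusAdd K m x = a * x + (a * x) ^ 3 ^ m := by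
    rw [frobeniusAdd_apply, mul_pow, ha]
    ring
  rw [this, map_add]
  simp_rw [frobeniusSum_apply]
  rw [two_mul, Finset.sum_range_add]
  simp_rw [pow_add, pow_mul]

variable [Finite K]

theorem range_frobeniusSub_one {d : ℕ} (hd : 0 < d) (hK : Nat.card K = 3 ^ d) :
    (frobeniusSub K 1).range = (frobeniusSum K d).ker ∧ Nat.card (frobeniusSub K 1).ker = 3 ∧
      Nat.card (frobeniusSum K d).ker = 3 ^ (d - 1) := by
  refine range_eq_ker_of_card_ker_le (fun x => ?_)
    ((card_ker_frobeniusSub_le one_pos).trans_eq (pow_one 3)) (card_ker_frobeniusSum_le hd) ?_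
  · rw [frobeniusSub_apply, pow_one, map_sub, frobeniusSum_pow_three_sub,
      pow_three_pow_eq_self hK, sub_self]
  · rw [hK, ← pow_succ', Nat.sub_add_cancel hd]

theorem card_ker_frobeniusSub_and_frobeniusAdd {m : ℕ} (hm : 0 < m)
    (hK : Nat.card K = 3 ^ (2 * m)) :
    Nat.card (frobeniusSub K m).ker = 3 ^ m ∧ Nat.card (frobeniusAdd K m).ker = 3 ^ m := by
  have hcomp : ∀ x, frobeniusAdd K m (frobeniusSub K m x) = 0 := by
    intro x
    have h : (x ^ 3 ^ m) ^ 3 ^ m = x := by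
      rw [← pow_mul, ← pow_add, ← two_mul, pow_three_pow_eq_self hK]
    rw [frobeniusSub_apply, map_sub, frobeniusAdd_apply, frobeniusAdd_apply, h, add_comm, sub_self]
  exact (range_eq_ker_of_card_ker_le hcomp (card_ker_frobeniusSub_le hm)
    (card_ker_frobeniusAdd_le hm) (by rw [hK, ← pow_add, two_mul])).2

theorem card_ker_frobeniusSum {n : ℕ} (hn : 0 < n)
    (h : Nat.card (frobeniusSub K n).ker = 3 ^ n) :
    Nat.card (frobeniusSum K n).ker = 3 ^ (n - 1) := by
  refine le_antisymm (card_ker_frobeniusSum_le hn) ?_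
  have key := card_ker_comp_le (frobeniusSub K 1) (frobeniusSum K n)
  have hcomp : (frobeniusSub K 1).comp (frobeniusSum K n) = frobeniusSub K n := by
    ext x
    rw [AddMonoidHom.comp_apply, frobeniusSub_apply, pow_one, frobeniusSum_pow_three,
      frobeniusSum_pow_three_sub, frobeniusSub_apply]
  have hpow : 3 ^ n = 3 ^ (n - 1) * 3 := by rw [← pow_succ, Nat.sub_add_cancel hn]
  rw [hcomp, h, hpow] at key
  have h3 : Nat.card (frobeniusSub K 1).ker ≤ 3 ^ 1 := card_ker_frobeniusSub_le one_pos
  exact Nat.le_of_mul_le_mul_right (key.trans (Nat.mul_le_mul_left _ h3)) (by norm_num)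

end CharThree

section QuadraticCharacter

open Finset

variable {K : Type*} [Field K] [Fintype K] [DecidableEq K] [CharP K 3] {m : ℕ}

theorem neg_one_pow_three_pow_add_one_half (m : ℕ) :
    (-1 : ℤ) ^ ((3 ^ m + 1) / 2) = -(-1) ^ m := by
  induction m with
  | zero => norm_num
  | succ m ih =>
    have hodd : Odd (3 ^ m) := Odd.pow (by decide)
    have : (3 ^ (m + 1) + 1) / 2 = (3 ^ m + 1) / 2 + 3 ^ m := by
      rw [pow_succ]
      omega
    rw [this, pow_add, ih, hodd.neg_one_pow, pow_succ, neg_mul]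

theorem coe_quadraticChar_eq_pow (hK : Fintype.card K = 3 ^ (2 * m)) (a : K) :
    (quadraticChar K a : K) = (a ^ (3 ^ m - 1)) ^ ((3 ^ m + 1) / 2) := by
  rw [quadraticChar_eq_pow_of_char_ne_two' (ringChar_ne_two_of_charP_three K), hK, ← pow_mul]
  congr 1
  obtain ⟨k, hk⟩ : Odd (3 ^ m) := Odd.pow (by decide)
  rw [mul_comm 2, pow_mul, hk]
  have h1 : (2 * k + 1 + 1) / 2 = k + 1 := by omega
  have h2 : (2 * k + 1) ^ 2 = 2 * (2 * k * (k + 1)) + 1 := by ring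
  rw [h1, h2, Nat.add_sub_cancel]
  omega

theorem quadraticChar_eq_of_coe_eq {a : K} (ha : a ≠ 0) {e : ℤ} (he : e = 1 ∨ e = -1)
    (h : (quadraticChar K a : K) = e) : quadraticChar K a = e := by
  have h2 : (1 : K) ≠ -1 := (Ring.neg_one_ne_one_of_char_ne_two
    (ringChar_ne_two_of_charP_three K)).symm
  rcases quadraticChar_dichotomy ha with h' | h' <;> rcases he with rfl | rfl <;>
    rw [h'] at h ⊢ <;> simp only [Int.cast_one, Int.cast_neg] at h
  · exact absurd h h2
  · exact absurd h.symm h2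

theorem quadraticChar_eq_one_of_pow_eq_self (hK : Fintype.card K = 3 ^ (2 * m)) {a : K}
    (ha : a ≠ 0) (h : a ^ 3 ^ m = a) : quadraticChar K a = 1 := by
  refine quadraticChar_eq_of_coe_eq ha (Or.inl rfl) ?_
  have : a ^ (3 ^ m - 1) = 1 := by
    refine mul_right_cancel₀ ha ?_
    rw [← pow_succ, Nat.sub_add_cancel (Nat.one_le_pow _ _ (by norm_num)), h, one_mul]
  rw [coe_quadraticChar_eq_pow hK, this, one_pow, Int.cast_one]

theorem quadraticChar_eq_of_pow_eq_neg_self (hK : Fintype.card K = 3 ^ (2 * m)) {a : K}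
    (ha : a ≠ 0) (h : a ^ 3 ^ m = -a) : quadraticChar K a = -(-1) ^ m := by
  rw [← neg_one_pow_three_pow_add_one_half]
  refine quadraticChar_eq_of_coe_eq ha (neg_one_pow_eq_or ℤ _) ?_
  have : a ^ (3 ^ m - 1) = -1 := by
    refine mul_right_cancel₀ ha ?_
    rw [← pow_succ, Nat.sub_add_cancel (Nat.one_le_pow _ _ (by norm_num)), h, neg_one_mul]
  rw [coe_quadraticChar_eq_pow hK, this]
  push_cast
  rfl

theorem card_filter_pow_eq_self (hm : 0 < m) (hK : Fintype.card K = 3 ^ (2 * m)) :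
    #{a : K | a ^ 3 ^ m = a} = 3 ^ m := by
  refine Eq.trans ?_ (card_ker_frobeniusSub_and_frobeniusAdd (K := K) hm
    (Nat.card_eq_fintype_card.trans hK)).1
  rw [← card_filter_eq_zero]
  simp_rw [frobeniusSub_apply, sub_eq_zero]

theorem card_filter_frobeniusSum_mul_eq_zero (hm : 0 < m) (hK : Fintype.card K = 3 ^ (2 * m))
    (x : K) : #{a ∈ ({a | a ^ 3 ^ m = a} : Finset K) | frobeniusSum K (2 * m) (a * x) = 0} =
      if frobeniusAdd K m x = 0 then 3 ^ m else 3 ^ (m - 1) := by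
  have hK' := Nat.card_eq_fintype_card.trans hK
  split_ifs with hx
  · refine Eq.trans ?_ (card_filter_pow_eq_self hm hK)
    rw [filter_true_of_mem]
    intro a ha
    rw [frobeniusSum_two_mul_mul (by simpa using ha), hx, mul_zero, map_zero]
  · rw [← card_ker_frobeniusSum hm (card_ker_frobeniusSub_and_frobeniusAdd hm hK').1,
      ← card_filter_eq_zero]
    refine card_bij (fun a _ => a * frobeniusAdd K m x) ?_ ?_ ?_
    · intro a ha
      simp only [mem_filter, mem_univ, true_and] at ha ⊢
      rw [← frobeniusSum_two_mul_mul ha.1, ha.2]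
    · intro a _ b _ h
      exact mul_right_cancel₀ hx h
    · intro z hz
      simp only [mem_filter, mem_univ, true_and] at hz
      have hz' : z ^ 3 ^ m = z := by
        rw [← sub_eq_zero, ← frobeniusSum_pow_three_sub, ← frobeniusSum_pow_three, hz]
        simp
      have hw : frobeniusAdd K m x ^ 3 ^ m = frobeniusAdd K m x := by
        rw [frobeniusAdd_apply, add_pow_char_pow, ← pow_mul, ← pow_add, ← two_mul,
          pow_three_pow_eq_self hK', add_comm]
      have ha : (z * (frobeniusAdd K m x)⁻¹) ^ 3 ^ m = z * (frobeniusAdd K m x)⁻¹ := by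
        rw [mul_pow, inv_pow, hz', hw]
      refine ⟨z * (frobeniusAdd K m x)⁻¹, ?_, inv_mul_cancel_right₀ hx z⟩
      simp only [mem_filter, mem_univ, true_and]
      refine ⟨ha, ?_⟩
      rw [frobeniusSum_two_mul_mul ha, inv_mul_cancel_right₀ hx, hz]

theorem sum_quadraticChar_frobeniusAdd_eq_zero (hm : 0 < m) (hK : Fintype.card K = 3 ^ (2 * m)) :
    ∑ x : K with frobeniusAdd K m x = 0, quadraticChar K x = (3 ^ m - 1) * -(-1) ^ m := by
  have h0 : (0 : K) ∈ ({x | frobeniusAdd K m x = 0} : Finset K) := by simp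
  have hcard := card_filter_eq_zero (frobeniusAdd K m)
  rw [(card_ker_frobeniusSub_and_frobeniusAdd hm (Nat.card_eq_fintype_card.trans hK)).2] at hcard
  rw [← add_sum_erase _ _ h0, MulChar.map_zero, zero_add, sum_eq_card_nsmul (b := -(-1) ^ m),
    card_erase_of_mem h0, hcard, nsmul_eq_mul, Nat.cast_sub (Nat.one_le_pow _ _ (by norm_num))]
  · push_cast
    rfl
  · intro x hx
    simp only [mem_erase, mem_filter, mem_univ, true_and, frobeniusAdd_apply] at hx
    exact quadraticChar_eq_of_pow_eq_neg_self hK hx.1 (eq_neg_of_add_eq_zero_left hx.2)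

theorem sum_quadraticChar_frobeniusSum_eq_zero (hm : 0 < m)
    (hK : Fintype.card K = 3 ^ (2 * m)) :
    ∑ x : K with frobeniusSum K (2 * m) x = 0, quadraticChar K x =
      -(-1) ^ m * (2 * 3 ^ (m - 1)) := by
  set S := ∑ x : K with frobeniusSum K (2 * m) x = 0, quadraticChar K x with hS
  set F : Finset K := {a | a ^ 3 ^ m = a} with hF
  have h0 : (0 : K) ∈ F := by simp [hF]
  have hsum := quadraticChar_sum_zero (F := K) (ringChar_ne_two_of_charP_three K)
  have hpow : (3 : ℤ) ^ m = 3 * 3 ^ (m - 1) := by rw [← pow_succ', Nat.sub_add_cancel hm]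
  have left : ∑ a ∈ F, ∑ x : K with frobeniusSum K (2 * m) (a * x) = 0, quadraticChar K x =
      (3 ^ m - 1) * S := by
    rw [← add_sum_erase _ _ h0, sum_eq_card_nsmul (s := F.erase 0) (b := S), card_erase_of_mem h0,
      card_filter_pow_eq_self hm hK, nsmul_eq_mul, Nat.cast_sub (Nat.one_le_pow _ _ (by norm_num))]
    · simp only [zero_mul, map_zero, filter_true, hsum, zero_add]
      push_cast
      rfl
    · intro a ha
      simp only [mem_erase, hF, mem_filter, mem_univ, true_and] at ha
      rw [hS]
      refine sum_equiv (Equiv.mulLeft₀ a ha.1) (fun x => by simp) fun x _ => ?_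
      rw [Equiv.mulLeft₀_apply, map_mul, quadraticChar_eq_one_of_pow_eq_self hK ha.1 ha.2, one_mul]
  have right : ∑ a ∈ F, ∑ x : K with frobeniusSum K (2 * m) (a * x) = 0, quadraticChar K x =
      (3 ^ m - 3 ^ (m - 1)) * ((3 ^ m - 1) * -(-1) ^ m) := by
    simp_rw [sum_filter]
    rw [sum_comm, ← sum_quadraticChar_frobeniusAdd_eq_zero hm hK, sum_filter, mul_sum]
    have hx : ∀ x : K, ∑ a ∈ F, (if frobeniusSum K (2 * m) (a * x) = 0 then quadraticChar K x
        else 0) = (3 ^ m - 3 ^ (m - 1)) * (if frobeniusAdd K m x = 0 then quadraticChar K x else 0)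
          + 3 ^ (m - 1) * quadraticChar K x := by
      intro x
      rw [← sum_filter, sum_const, card_filter_frobeniusSum_mul_eq_zero hm hK, nsmul_eq_mul]
      split_ifs <;> push_cast <;> ring
    rw [sum_congr rfl fun x _ => hx x, sum_add_distrib, ← mul_sum univ (quadraticChar K), hsum,
      mul_zero, add_zero]
  have hne : (3 : ℤ) ^ m - 1 ≠ 0 := sub_ne_zero.mpr (one_lt_pow₀ (by norm_num) hm.ne').ne'
  refine mul_left_cancel₀ hne ?_
  rw [← left, right, hpow]
  ring

theorem sum_comp_sq {K : Type*} [Field K] [Fintype K] [DecidableEq K] (hK : ringChar K ≠ 2)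
    (f : K → ℤ) : ∑ y, f (y ^ 2) = ∑ x, (quadraticChar K x + 1) * f x := by
  rw [← sum_fiberwise univ (fun y : K => y ^ 2)]
  refine sum_congr rfl fun x _ => ?_
  rw [sum_congr rfl (g := fun _ => f x), sum_const, nsmul_eq_mul, ← quadraticChar_card_sqrts hK x]
  · simp
  · simp +contextual

theorem three_mul_card_frobeniusSum_sq_eq_zero (hm : 0 < m)
    (hK : Fintype.card K = 3 ^ (2 * m)) :
    3 * (#{y : K | frobeniusSum K (2 * m) (y ^ 2) = 0} : ℤ) = 3 ^ (2 * m) - 2 * (-3) ^ m := by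
  have hcard := card_filter_eq_zero (frobeniusSum K (2 * m))
  rw [(range_frobeniusSub_one (by omega) (Nat.card_eq_fintype_card.trans hK)).2.2] at hcard
  have h := sum_comp_sq (K := K) (ringChar_ne_two_of_charP_three K)
    (fun x => if frobeniusSum K (2 * m) x = 0 then 1 else 0)
  simp only [mul_ite, mul_one, mul_zero, ← sum_filter, sum_add_distrib,
    sum_quadraticChar_frobeniusSum_eq_zero hm hK, sum_const, nsmul_eq_mul, hcard] at h
  rw [h, neg_pow (3 : ℤ) m]
  obtain ⟨k, rfl⟩ : ∃ k, m = k + 1 := ⟨m - 1, by omega⟩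
  have h1 : 2 * (k + 1) - 1 = 2 * k + 1 := by omega
  rw [h1, Nat.add_sub_cancel]
  push_cast
  ring

theorem two_mul_card_frobeniusSum_sq_eq (hK : Fintype.card K = 3 ^ (2 * m))
    {z : K} (hz : frobeniusSum K (2 * m) z ≠ 0) :
    #{y : K | frobeniusSum K (2 * m) (y ^ 2) = 0} +
      2 * #{y : K | frobeniusSum K (2 * m) (y ^ 2) = frobeniusSum K (2 * m) z} =
        3 ^ (2 * m) := by
  set t := frobeniusSum K (2 * m) z with ht
  have hcube : ∀ x : K, frobeniusSum K (2 * m) x ^ 3 = frobeniusSum K (2 * m) x := by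
    intro x
    rw [← sub_eq_zero, frobeniusSum_pow_three, frobeniusSum_pow_three_sub,
      pow_three_pow_eq_self (Nat.card_eq_fintype_card.trans hK), sub_self]
  have ht2 : t ^ 2 = 1 := mul_right_cancel₀ hz (by rw [← pow_succ, hcube, one_mul])
  have htt : t ≠ -t := fun h => hz <| by
    have h3 : (3 : K) = 0 := CharP.cast_eq_zero K 3
    linear_combination t * h3 - h
  obtain ⟨i, hi⟩ : IsSquare (-1 : K) := by
    rw [FiniteField.isSquare_neg_one_iff, hK, pow_mul, Nat.pow_mod]
    norm_num
  have hi0 : i ≠ 0 := by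
    rintro rfl
    simp at hi
  have hneg : #{y : K | frobeniusSum K (2 * m) (y ^ 2) = -t} =
      #{y : K | frobeniusSum K (2 * m) (y ^ 2) = t} := by
    refine card_equiv (Equiv.mulLeft₀ i hi0) fun y => ?_
    simp only [mem_filter, mem_univ, true_and, Equiv.mulLeft₀_apply]
    rw [mul_pow, sq i, ← hi, neg_one_mul, map_neg, neg_eq_iff_eq_neg]
  have htri : ∀ y : K, frobeniusSum K (2 * m) (y ^ 2) = 0 ∨
      frobeniusSum K (2 * m) (y ^ 2) = t ∨ frobeniusSum K (2 * m) (y ^ 2) = -t := by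
    intro y
    rw [← sq_eq_sq_iff_eq_or_eq_neg, ht2]
    refine or_iff_not_imp_left.mpr fun h => mul_right_cancel₀ h ?_
    rw [← pow_succ, hcube, one_mul]
  have hsum : ∀ y : K, (if frobeniusSum K (2 * m) (y ^ 2) = 0 then 1 else 0) +
      ((if frobeniusSum K (2 * m) (y ^ 2) = t then 1 else 0) +
        (if frobeniusSum K (2 * m) (y ^ 2) = -t then 1 else 0)) = 1 := by
    intro y
    rcases htri y with h | h | h <;> simp [h, hz, hz.symm, htt, htt.symm]
  have := sum_congr (rfl : (univ : Finset K) = univ) fun y _ => hsum y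
  rw [sum_add_distrib, sum_add_distrib, ← card_filter, ← card_filter, ← card_filter, hneg,
    ← two_mul, ← card_eq_sum_ones, card_univ, hK] at this
  exact this

theorem card_sq_eq_pow_three_sub_add {d : ℕ} (hd : 0 < d) (hK : Fintype.card K = 3 ^ d) (z : K) :
    Nat.card {P : K × K // P.2 ^ 2 = P.1 ^ 3 - P.1 + z} =
      #{y : K | frobeniusSum K d (y ^ 2) = frobeniusSum K d z} * 3 := by
  obtain ⟨hrange, hker, -⟩ := range_frobeniusSub_one hd (Nat.card_eq_fintype_card.trans hK)
  have hmem : ∀ y : K, frobeniusSum K d (y ^ 2) = frobeniusSum K d z ↔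
      ∃ x, x ^ 3 - x = y ^ 2 - z := by
    intro y
    rw [← sub_eq_zero, ← map_sub, ← AddMonoidHom.mem_ker, ← hrange]
    simp [AddMonoidHom.mem_range, frobeniusSub_apply]
  rw [Nat.card_eq_fintype_card, Fintype.card_subtype,
    card_eq_sum_card_fiberwise (f := Prod.snd)
      (t := ({y : K | frobeniusSum K d (y ^ 2) = frobeniusSum K d z} : Finset K))]
  · refine sum_const_nat fun y hy => ?_
    obtain ⟨x₀, hx₀⟩ := (hmem y).mp (by simpa using hy)
    refine Eq.trans ?_ hker
    rw [← card_filter_eq_zero]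
    symm
    refine card_bij (fun x _ => (x + x₀, y)) ?_ ?_ ?_
    · intro x hx
      simp only [mem_filter, mem_univ, true_and, frobeniusSub_apply, pow_one, and_true] at hx ⊢
      rw [add_pow_char]
      linear_combination -hx - hx₀
    · intro x _ x' _ h
      exact add_right_cancel (Prod.ext_iff.mp h).1
    · rintro ⟨x, y'⟩ hx
      simp only [mem_filter, mem_univ, true_and] at hx
      obtain ⟨hx, rfl⟩ := hx
      refine ⟨x - x₀, ?_, by simp⟩
      simp only [mem_filter, mem_univ, true_and, frobeniusSub_apply, pow_one]
      rw [sub_pow_char]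
      linear_combination -hx - hx₀
  · rintro ⟨x, y⟩ hx
    simp only [coe_filter, mem_univ, true_and, Set.mem_ofPred_eq] at hx ⊢
    exact (hmem y).mpr ⟨x, by rw [hx]; ring⟩

end QuadraticCharacter

theorem card_sq_eq_pow_three_sub_mul_add {K : Type*} [Field K] {u : K} (hu : u ≠ 0) (c : K) :
    Nat.card {P : K × K // P.2 ^ 2 = P.1 ^ 3 - u ^ 4 * P.1 + c} =
      Nat.card {P : K × K // P.2 ^ 2 = P.1 ^ 3 - P.1 + c * u⁻¹ ^ 6} := by
  symm
  refine Nat.card_congr (((Equiv.mulLeft₀ (u ^ 2) (pow_ne_zero 2 hu)).prodCongr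
    (Equiv.mulLeft₀ (u ^ 3) (pow_ne_zero 3 hu))).subtypeEquiv fun P => ?_)
  simp only [Equiv.prodCongr_apply, Prod.map_fst, Prod.map_snd, Equiv.mulLeft₀_apply]
  have h : (u ^ 3 * P.2) ^ 2 - ((u ^ 2 * P.1) ^ 3 - u ^ 4 * (u ^ 2 * P.1) + c) =
      u ^ 6 * (P.2 ^ 2 - (P.1 ^ 3 - P.1 + c * u⁻¹ ^ 6)) := by
    field_simp
  rw [← sub_eq_zero, ← sub_eq_zero (a := (u ^ 3 * P.2) ^ 2), h,
    mul_eq_zero_iff_left (pow_ne_zero 6 hu)]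

/-- Point counts for supersingular elliptic curves `y² = x³ - bx + c` over `F_q`,
`q = 3^d` with `d` even and positive, when `b = u⁴` is a fourth power and
`Tr_{F_q/F_3}(c·u⁻⁶) ≠ 0`: the number of affine points is `q + (-3)^(d/2)`
(the trace of Frobenius is `-(-3)^(d/2)`). -/
theorem stmt_16 (d : ℕ) (hd : Even d) (hd0 : 0 < d) (q : ℕ) (hq : q = 3 ^ d)
    (K : Type*) [Field K] [Fintype K] (hK : Fintype.card K = q)
    (b c u : K) (hu : u ≠ 0) (hb : b = u ^ 4)
    (htr : ∑ i ∈ Finset.range d, (c * u⁻¹ ^ 6) ^ 3 ^ i ≠ 0) :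
    (Nat.card {P : K × K // P.2 ^ 2 = P.1 ^ 3 - b * P.1 + c} : ℤ)
      = (q : ℤ) + (-3) ^ (d / 2) := by
  classical
  obtain ⟨m, rfl⟩ := hd.exists_two_nsmul
  rw [smul_eq_mul] at *
  subst hq hb
  have hm : 0 < m := by omega
  have : Fact (Nat.Prime 3) := ⟨Nat.prime_three⟩
  have : CharP K 3 := charP_of_card_eq_prime_pow hK
  rw [← frobeniusSum_apply] at htr
  have hzero := three_mul_card_frobeniusSum_sq_eq_zero hm hK
  have hsum := congrArg (Nat.cast : ℕ → ℤ) (two_mul_card_frobeniusSum_sq_eq hK htr)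
  rw [card_sq_eq_pow_three_sub_mul_add hu, card_sq_eq_pow_three_sub_add hd0 hK,
    Nat.mul_div_cancel_left m two_pos]
  push_cast at hsum ⊢
  linarith
end
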